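/- Let W be a complex reflection group acting on a complex vector space h of dimension ℓ, with degrees d_1,…,d_ℓ of the basic invariants. Then, as rational functions in t and y: (1/|W|)·Σ_{w∈W} det(1 + y·w)/det(1 − t·w) = Π_{i=1}^ℓ (1 + y·t^{d_i−1})/(1 − t^{d_i}). -/

import Mathlib

open Module

namespace Solomon

open MvPolynomial

section LinearSubstitution

variable {ι : Type*} [Fintype ι]

/-- The linear substitution of variables `p ↦ p ∘ A`. -/
noncomputable def subst (A : Matrix ι ι ℂ) : MvPolynomial ι ℂ →ₐ[ℂ] MvPolynomial ι ℂ :=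
  aeval fun i => ∑ j, C (A i j) * X j

theorem subst_X (A : Matrix ι ι ℂ) (i : ι) : subst A (X i) = ∑ j, C (A i j) * X j := by
  simp [subst]

theorem eval_subst (A : Matrix ι ι ℂ) (v : ι → ℂ) (p : MvPolynomial ι ℂ) :
    eval v (subst A p) = eval (A.mulVec v) p := by
  induction p using MvPolynomial.induction_on with
  | C a => simp [subst]
  | add p q hp hq => simp [hp, hq]
  | mul_X p i hp => simp [hp, subst_X, Matrix.mulVec, dotProduct]

theorem subst_mul (A B : Matrix ι ι ℂ) (p : MvPolynomial ι ℂ) :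
    subst (A * B) p = subst B (subst A p) :=
  MvPolynomial.funext fun v => by simp [eval_subst]

theorem subst_one [DecidableEq ι] (p : MvPolynomial ι ℂ) : subst 1 p = p :=
  MvPolynomial.funext fun v => by simp [eval_subst]

theorem isHomogeneous_subst (A : Matrix ι ι ℂ) {p : MvPolynomial ι ℂ} {n : ℕ}
    (hp : p.IsHomogeneous n) : (subst A p).IsHomogeneous n := by
  have := hp.aeval (fun i => ∑ j, C (A i j) * X j) (n := 1) fun i =>
    IsHomogeneous.sum _ _ _ fun j _ => isHomogeneous_C_mul_X _ _
  simpa [subst] using this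

/-- The derivative of `p` in the constant direction `v`. -/
noncomputable def dirDeriv (v : ι → ℂ) : MvPolynomial ι ℂ →ₗ[ℂ] MvPolynomial ι ℂ :=
  ∑ j, v j • (pderiv j).toLinearMap

theorem dirDeriv_apply (v : ι → ℂ) (p : MvPolynomial ι ℂ) :
    dirDeriv v p = ∑ j, v j • pderiv j p := by
  simp [dirDeriv]

theorem dirDeriv_subst (A : Matrix ι ι ℂ) (v : ι → ℂ) (p : MvPolynomial ι ℂ) :
    dirDeriv v (subst A p) = subst A (dirDeriv (A.mulVec v) p) := by
  classical
  induction p using MvPolynomial.induction_on with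
  | C a => simp [dirDeriv_apply, subst]
  | add p q hp hq => simp [hp, hq]
  | mul_X p i hp =>
    have hmul : ∀ (w : ι → ℂ) (p q : MvPolynomial ι ℂ),
        dirDeriv w (p * q) = dirDeriv w p * q + p * dirDeriv w q := by
      intro w p q
      simp only [dirDeriv_apply, pderiv_mul, smul_add, Finset.sum_add_distrib, Finset.sum_mul,
        Finset.mul_sum, smul_mul_assoc, mul_smul_comm]
    have hX : ∀ (w : ι → ℂ) (i : ι), dirDeriv w (X i) = C (w i) := by
      intro w i
      simp [dirDeriv_apply, pderiv_X, Pi.single_apply, smul_eq_C_mul]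
    rw [hmul, map_mul, hmul, map_add, map_mul, map_mul, hp, hX]
    congr 2
    simp only [subst_X, map_sum, C_mul', map_smul, hX]
    simp [subst, Matrix.mulVec, dotProduct, smul_eq_C_mul]

theorem isHomogeneous_dirDeriv (v : ι → ℂ) {p : MvPolynomial ι ℂ} {n : ℕ}
    (hp : p.IsHomogeneous n) : (dirDeriv v p).IsHomogeneous (n - 1) := by
  rw [dirDeriv_apply]
  exact IsHomogeneous.sum _ _ _ fun j _ => by
    rw [smul_eq_C_mul]; exact hp.pderiv.C_mul _

theorem homogeneousComponent_mul_of_isHomogeneous {σ : Type*} {q : MvPolynomial σ ℂ} {d : ℕ}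
    (hq : q.IsHomogeneous d) (p : MvPolynomial σ ℂ) (n : ℕ) :
    homogeneousComponent n (p * q) =
      if d ≤ n then homogeneousComponent (n - d) p * q else 0 := by
  have key : ∀ k, homogeneousComponent n (homogeneousComponent k p * q) =
      if n = k + d then homogeneousComponent k p * q else 0 := fun k =>
    homogeneousComponent_of_mem ((homogeneousComponent_isHomogeneous k p).mul hq)
  conv_lhs => rw [← sum_homogeneousComponent p, Finset.sum_mul, map_sum]
  simp only [key]
  split_ifs with h
  · rw [Finset.sum_eq_single (n - d)]
    · rw [if_pos (by omega)]
    · intro b _ hb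
      rw [if_neg (by omega)]
    · intro hb
      rw [if_pos (by omega),
        homogeneousComponent_eq_zero _ _ (by rw [Finset.mem_range] at hb; omega),
        zero_mul]
  · exact Finset.sum_eq_zero fun k _ => if_neg (by omega)

theorem homogeneousComponent_subst (A : Matrix ι ι ℂ) (p : MvPolynomial ι ℂ) (n : ℕ) :
    homogeneousComponent n (subst A p) = subst A (homogeneousComponent n p) := by
  have key : ∀ k, homogeneousComponent n (subst A (homogeneousComponent k p)) =
      if n = k then subst A (homogeneousComponent k p) else 0 := fun k =>
    homogeneousComponent_of_mem (isHomogeneous_subst A (homogeneousComponent_isHomogeneous k p))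
  conv_lhs => rw [← sum_homogeneousComponent p, map_sum, map_sum]
  simp only [key]
  by_cases h : n < p.totalDegree + 1
  · rw [Finset.sum_eq_single n (fun b _ hb => if_neg (Ne.symm hb)) (fun hb => by simp_all),
      if_pos rfl]
  · rw [homogeneousComponent_eq_zero n p (by omega), map_zero]
    exact Finset.sum_eq_zero fun k hk => if_neg (by simp at hk; omega)

theorem isHomogeneous_of_isHomogeneous_mul {σ : Type*} {p q : MvPolynomial σ ℂ} {m n : ℕ}
    (hq : q.IsHomogeneous n) (hq0 : q ≠ 0) (h : (p * q).IsHomogeneous (m + n)) :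
    p.IsHomogeneous m := by
  have h1 := homogeneousComponent_mul_of_isHomogeneous hq p (m + n)
  rw [homogeneousComponent_eq_self h, if_pos (by omega), Nat.add_sub_cancel] at h1
  rw [mul_right_cancel₀ hq0 h1]
  exact homogeneousComponent_isHomogeneous _ _

theorem homogeneousComponent_mem_span {σ : Type*} {H : Set (MvPolynomial σ ℂ)}
    (hH : ∀ h ∈ H, ∃ d, h.IsHomogeneous d) {p : MvPolynomial σ ℂ} (hp : p ∈ Ideal.span H)
    (n : ℕ) : homogeneousComponent n p ∈ Ideal.span H := by
  let _ := MvPolynomial.gradedAlgebra (σ := σ) (R := ℂ)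
  exact homogeneousComponent_mem_of_mem (Ideal.homogeneous_span _ _ fun h hh => hH h hh) hp n

end LinearSubstitution

end Solomon

namespace Solomon

open MvPolynomial

section Invariants

variable {ι G : Type*} [Fintype ι] [DecidableEq ι] [Group G]
  (τ : G →* Matrix ι ι ℂ)

/-- The algebra of polynomials invariant under the linear group `τ`. -/
noncomputable def invariantSubalgebra : Subalgebra ℂ (MvPolynomial ι ℂ) where
  carrier := {p | ∀ g, subst (τ g) p = p}
  mul_mem' hp hq g := by simp [hp g, hq g]
  add_mem' hp hq g := by simp [hp g, hq g]
  algebraMap_mem' r g := by simp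

variable {τ}

theorem mem_invariantSubalgebra {p : MvPolynomial ι ℂ} :
    p ∈ invariantSubalgebra τ ↔ ∀ g, subst (τ g) p = p := Iff.rfl

theorem homogeneousComponent_mem_invariantSubalgebra {p : MvPolynomial ι ℂ}
    (hp : p ∈ invariantSubalgebra τ) (n : ℕ) :
    homogeneousComponent n p ∈ invariantSubalgebra τ := fun g => by
  rw [← homogeneousComponent_subst, hp g]

variable (τ)

/-- The homogeneous invariants of positive degree. -/
def positiveInvariants : Set (MvPolynomial ι ℂ) :=
  {p | p ∈ invariantSubalgebra τ ∧ ∃ n, 0 < n ∧ p.IsHomogeneous n}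

/-- The ideal generated by the homogeneous invariants of positive degree. -/
noncomputable def hilbertIdeal : Ideal (MvPolynomial ι ℂ) := Ideal.span (positiveInvariants τ)

/-- The element `g` fixes a hyperplane `L = 0` pointwise. -/
def FixesHyperplane (g : G) : Prop :=
  ∃ L : MvPolynomial ι ℂ, L ≠ 0 ∧ L.IsHomogeneous 1 ∧ ∀ p, L ∣ subst (τ g) p - p

variable {τ}

theorem subst_mem_hilbertIdeal (g : G) {p : MvPolynomial ι ℂ} (hp : p ∈ hilbertIdeal τ) :
    subst (τ g) p ∈ hilbertIdeal τ := by
  induction hp using Submodule.span_induction with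
  | mem x hx => rw [hx.1 g]; exact Ideal.subset_span hx
  | zero => simp
  | add x y _ _ hx hy => rw [map_add]; exact add_mem hx hy
  | smul a x _ hx => rw [smul_eq_mul, map_mul]; exact Ideal.mul_mem_left _ _ hx

theorem exists_mem_span_subst_sub_eq {H : Set (MvPolynomial ι ℂ)}
    (hH : H ⊆ invariantSubalgebra τ) {g : G} {L : MvPolynomial ι ℂ}
    (hL : ∀ p, L ∣ subst (τ g) p - p) {x : MvPolynomial ι ℂ} (hx : x ∈ Ideal.span H) :
    ∃ y ∈ Ideal.span H, subst (τ g) x - x = L * y := by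
  induction hx using Submodule.span_induction with
  | mem x hx => exact ⟨0, zero_mem _, by rw [hH hx g]; simp⟩
  | zero => exact ⟨0, zero_mem _, by simp⟩
  | add x y _ _ hx hy =>
    obtain ⟨u, hu, hu'⟩ := hx
    obtain ⟨v, hv, hv'⟩ := hy
    exact ⟨u + v, add_mem hu hv, by rw [map_add, mul_add, ← hu', ← hv']; ring⟩
  | smul a x hx' hx =>
    obtain ⟨u, hu, hu'⟩ := hx
    obtain ⟨b, hb⟩ := hL a
    refine ⟨subst (τ g) a * u + b * x, add_mem (Ideal.mul_mem_left _ _ hu)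
      (Ideal.mul_mem_left _ _ hx'), ?_⟩
    rw [smul_eq_mul, map_mul]
    linear_combination subst (τ g) a * hu' + x * hb

variable [Fintype G]

variable (τ)

/-- The averaging operator over the group. -/
noncomputable def reynolds : MvPolynomial ι ℂ →ₗ[ℂ] MvPolynomial ι ℂ :=
  (Fintype.card G : ℂ)⁻¹ • ∑ g, (subst (τ g)).toLinearMap

variable {τ}

theorem reynolds_apply (p : MvPolynomial ι ℂ) :
    reynolds τ p = (Fintype.card G : ℂ)⁻¹ • ∑ g, subst (τ g) p := by
  simp [reynolds]

theorem reynolds_mem (p : MvPolynomial ι ℂ) : reynolds τ p ∈ invariantSubalgebra τ := fun g => by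
  rw [reynolds_apply, map_smul, map_sum]
  simp_rw [← subst_mul, ← map_mul]
  rw [Fintype.sum_equiv (Equiv.mulRight g) (fun x => subst (τ (x * g)) p)
    (fun x => subst (τ x) p) fun x => rfl]

theorem reynolds_mul (p : MvPolynomial ι ℂ) {r : MvPolynomial ι ℂ}
    (hr : r ∈ invariantSubalgebra τ) : reynolds τ (p * r) = reynolds τ p * r := by
  simp only [reynolds_apply, map_mul, hr _, Finset.sum_mul, smul_mul_assoc]

theorem reynolds_of_mem {r : MvPolynomial ι ℂ}
    (hr : r ∈ invariantSubalgebra τ) : reynolds τ r = r := by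
  simp [reynolds_apply, hr _, ← Nat.cast_smul_eq_nsmul ℂ, smul_smul]

theorem isHomogeneous_reynolds {p : MvPolynomial ι ℂ} {n : ℕ} (hp : p.IsHomogeneous n) :
    (reynolds τ p).IsHomogeneous n := by
  rw [reynolds_apply, smul_eq_C_mul]
  exact (IsHomogeneous.sum _ _ _ fun g _ => isHomogeneous_subst _ hp).C_mul _

/-- Chevalley's lemma: a homogeneous relation coefficient of an invariant `h₀` modulo an ideal
generated by invariants not containing `h₀` lies in the Hilbert ideal. -/
theorem mem_hilbertIdeal_of_mul_mem_of_isHomogeneous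
    (hgen : Subgroup.closure {g : G | FixesHyperplane τ g} = ⊤)
    {H : Set (MvPolynomial ι ℂ)} (hH : H ⊆ invariantSubalgebra τ)
    {h₀ : MvPolynomial ι ℂ} (hh₀ : h₀ ∈ invariantSubalgebra τ) (hnot : h₀ ∉ Ideal.span H) :
    ∀ (n : ℕ) (p : MvPolynomial ι ℂ), p.IsHomogeneous n → p * h₀ ∈ Ideal.span H →
      p ∈ hilbertIdeal τ
  | 0, p, hp, hmem => by
    have hC := homogeneousComponent_eq_self hp
    rw [homogeneousComponent_zero] at hC
    by_cases hc : coeff 0 p = 0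
    · rw [← hC, hc, map_zero]; exact zero_mem _
    · refine absurd ?_ hnot
      have := Ideal.mul_mem_left _ (C (coeff 0 p)⁻¹) hmem
      rwa [← hC, ← mul_assoc, coeff_C, if_pos rfl, ← C_mul, inv_mul_cancel₀ hc, C_1,
        one_mul] at this
  | n + 1, p, hp, hmem => by
    have hrefl : ∀ g : G, subst (τ g) p - p ∈ hilbertIdeal τ := by
      intro g
      have hg : g ∈ Subgroup.closure {g : G | FixesHyperplane τ g} := hgen ▸ Subgroup.mem_top g
      induction hg using Subgroup.closure_induction with
      | mem g hg =>
        obtain ⟨L, hL0, hL1, hL⟩ := hg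
        obtain ⟨q, hq⟩ := hL p
        have hqhom : q.IsHomogeneous n := by
          refine isHomogeneous_of_isHomogeneous_mul hL1 hL0 ?_
          rw [mul_comm, ← hq]
          exact (isHomogeneous_subst _ hp).sub hp
        have hqmem : q * h₀ ∈ Ideal.span H := by
          obtain ⟨y, hy, hy'⟩ := exists_mem_span_subst_sub_eq hH hL hmem
          rw [map_mul, hh₀ g, ← sub_mul, hq, mul_assoc] at hy'
          rwa [mul_left_cancel₀ hL0 hy']
        rw [hq]
        exact Ideal.mul_mem_left _ _
          (mem_hilbertIdeal_of_mul_mem_of_isHomogeneous hgen hH hh₀ hnot n q hqhom hqmem)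
      | one => simp [subst_one]
      | mul x y _ _ hx hy =>
        rw [map_mul, subst_mul]
        have := add_mem (subst_mem_hilbertIdeal y hx) hy
        rw [map_sub] at this
        simpa using this
      | inv x _ hx =>
        have := subst_mem_hilbertIdeal x⁻¹ hx
        rw [map_sub, ← subst_mul, ← map_mul, mul_inv_cancel, map_one, subst_one] at this
        rw [← neg_mem_iff]
        simpa using this
    have hsub : reynolds τ p - p ∈ hilbertIdeal τ := by
      have : reynolds τ p - p = C ((Fintype.card G : ℂ)⁻¹) * ∑ g, (subst (τ g) p - p) := by
        rw [Finset.sum_sub_distrib, mul_sub, reynolds_apply, smul_eq_C_mul]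
        simp [← Nat.cast_smul_eq_nsmul ℂ, ← smul_eq_C_mul, smul_smul]
      rw [this]
      exact Ideal.mul_mem_left _ _ (sum_mem fun g _ => hrefl g)
    have hR : reynolds τ p ∈ hilbertIdeal τ :=
      Ideal.subset_span ⟨reynolds_mem p, n + 1, n.succ_pos, isHomogeneous_reynolds hp⟩
    have := sub_mem hR hsub
    simpa using this

theorem mem_hilbertIdeal_of_mul_mem
    (hgen : Subgroup.closure {g : G | FixesHyperplane τ g} = ⊤)
    {H : Set (MvPolynomial ι ℂ)} (hH : H ⊆ invariantSubalgebra τ)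
    (hHhom : ∀ h ∈ H, ∃ d, h.IsHomogeneous d)
    {h₀ : MvPolynomial ι ℂ} (hh₀ : h₀ ∈ invariantSubalgebra τ) {d₀ : ℕ}
    (hd₀ : h₀.IsHomogeneous d₀) (hnot : h₀ ∉ Ideal.span H)
    {p : MvPolynomial ι ℂ} (hp : p * h₀ ∈ Ideal.span H) : p ∈ hilbertIdeal τ := by
  rw [← sum_homogeneousComponent p]
  refine sum_mem fun k _ => mem_hilbertIdeal_of_mul_mem_of_isHomogeneous hgen hH hh₀ hnot k _
    (homogeneousComponent_isHomogeneous _ _) ?_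
  have := homogeneousComponent_mem_span hHhom hp (k + d₀)
  rwa [homogeneousComponent_mul_of_isHomogeneous hd₀, if_pos (by omega),
    Nat.add_sub_cancel] at this

end Invariants

end Solomon

namespace Solomon

open MvPolynomial

section WeightedSubstitution

variable {ι κ : Type*} {f : κ → MvPolynomial ι ℂ} {e : κ → ℕ}

theorem isHomogeneous_aeval_of_isWeightedHomogeneous (hf : ∀ i, (f i).IsHomogeneous (e i))
    {h : MvPolynomial κ ℂ} {n : ℕ} (hh : h.IsWeightedHomogeneous e n) :
    (aeval f h).IsHomogeneous n := by
  rw [aeval_def, eval₂_eq]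
  refine IsHomogeneous.sum _ _ _ fun d hd => ?_
  rw [algebraMap_eq]
  refine IsHomogeneous.C_mul ?_ _
  rw [← hh (mem_support_iff.mp hd), Finsupp.weight_apply, Finsupp.sum]
  exact IsHomogeneous.prod _ _ _ fun i _ => by
    rw [smul_eq_mul, mul_comm]; exact (hf i).pow _

theorem homogeneousComponent_aeval (hf : ∀ i, (f i).IsHomogeneous (e i))
    (h : MvPolynomial κ ℂ) (n : ℕ) :
    homogeneousComponent n (aeval f h) = aeval f (weightedHomogeneousComponent e n h) := by
  induction h using MvPolynomial.induction_on' with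
  | add p q hp hq => simp only [map_add, hp, hq]
  | monomial d c =>
    have hd := isWeightedHomogeneous_monomial e d c (m := Finsupp.weight e d) rfl
    rw [homogeneousComponent_of_mem (isHomogeneous_aeval_of_isWeightedHomogeneous hf hd),
      weightedHomogeneousComponent_of_mem hd]
    split_ifs <;> simp

theorem derivation_aeval [Fintype κ] (D : Derivation ℂ (MvPolynomial ι ℂ) (MvPolynomial ι ℂ))
    (h : MvPolynomial κ ℂ) : D (aeval f h) = ∑ i, aeval f (pderiv i h) * D (f i) := by
  classical
  induction h using MvPolynomial.induction_on with
  | C a => simp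
  | add p q hp hq => simp only [map_add, hp, hq, add_mul, Finset.sum_add_distrib]
  | mul_X p i hp =>
    have hsingle : ∑ j, aeval f (pderiv j (X i : MvPolynomial κ ℂ)) * D (f j) = D (f i) := by
      rw [Finset.sum_eq_single i (fun j _ hj => by simp [pderiv_X_of_ne hj.symm]) (by simp)]
      simp
    simp only [map_mul, Derivation.leibniz, hp, smul_eq_mul, map_add, add_mul,
      Finset.sum_add_distrib, mul_assoc, ← Finset.mul_sum, hsingle, aeval_X]

theorem pderiv_eq_zero_of_isWeightedHomogeneous {h : MvPolynomial κ ℂ} {n : ℕ}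
    (hh : h.IsWeightedHomogeneous e n) {i : κ} (hi : n < e i) : pderiv i h = 0 := by
  refine MvPolynomial.ext _ _ fun m => ?_
  rw [coeff_pderiv, coeff_zero, hh.coeff_eq_zero, zero_mul]
  simp only [map_add, Finsupp.weight_single, smul_eq_mul, one_mul]
  omega

/-- A family of homogeneous polynomials of positive degree satisfying an algebraic relation
satisfies a weighted homogeneous one all of whose proper partial derivatives fail to be
relations. -/
theorem exists_minimal_relation (hf : ∀ i, (f i).IsHomogeneous (e i)) (he : ∀ i, 0 < e i)
    [Fintype κ] (hdep : ¬ AlgebraicIndependent ℂ f) :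
    ∃ (h : MvPolynomial κ ℂ) (n : ℕ), h.IsWeightedHomogeneous e n ∧ aeval f h = 0 ∧
      ∃ i, aeval f (pderiv i h) ≠ 0 := by
  classical
  have hex : ∃ n, ∃ h : MvPolynomial κ ℂ, h ≠ 0 ∧ h.IsWeightedHomogeneous e n ∧
      aeval f h = 0 := by
    rw [algebraicIndependent_iff] at hdep
    push Not at hdep
    obtain ⟨h, hh, hne⟩ := hdep
    by_contra! hcon
    refine hne ?_
    rw [← finsum_weightedHomogeneousComponent e h]
    refine finsum_eq_zero_of_forall_eq_zero fun n => ?_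
    by_contra hz
    refine hcon n _ hz (weightedHomogeneousComponent_isWeightedHomogeneous _ _) ?_
    rw [← homogeneousComponent_aeval hf, hh, map_zero]
  obtain ⟨h, hne, hw, h0⟩ := Nat.find_spec hex
  refine ⟨h, _, hw, h0, ?_⟩
  set k := Nat.find hex with hk
  by_contra! hall
  have hpd : ∀ i, pderiv i h = 0 := by
    intro i
    by_contra hi
    by_cases hik : e i ≤ k
    · have hlt : k - e i < k := Nat.sub_lt (by have := he i; omega) (he i)
      exact Nat.find_min hex hlt ⟨_, hi, hw.pderiv (by omega), hall i⟩
    · exact hi (pderiv_eq_zero_of_isWeightedHomogeneous hw (not_le.mp hik))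
  have heuler := hw.sum_weight_X_mul_pderiv
  simp only [hpd, mul_zero, smul_zero, Finset.sum_const_zero] at heuler
  have hk0 : k = 0 := by
    rcases smul_eq_zero.mp heuler.symm with h | h
    · exact h
    · exact absurd h hne
  rw [hk0] at hw
  have hC : h = C (coeff 0 h) := by
    have h1 := weightedHomogeneousComponent_zero h (w := e) (fun i => (he i).ne')
    rwa [hw.weightedHomogeneousComponent_same] at h1
  rw [hC, aeval_C, algebraMap_eq, C_eq_zero] at h0
  rw [hC, h0, map_zero] at hne
  exact hne rfl

end WeightedSubstitution

section Chevalley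

variable {ι G : Type*} [Fintype ι] [DecidableEq ι] [Group G]
  {τ : G →* Matrix ι ι ℂ}

theorem exists_minimal_generators (τ : G →* Matrix ι ι ℂ) :
    ∃ F : Finset (MvPolynomial ι ℂ), ↑F ⊆ positiveInvariants τ ∧
      Ideal.span (F : Set (MvPolynomial ι ℂ)) = hilbertIdeal τ ∧
      ∀ p ∈ F, p ∉ Ideal.span ((F : Set (MvPolynomial ι ℂ)) \ {p}) := by
  classical
  have hex : ∃ n, ∃ F : Finset (MvPolynomial ι ℂ), ↑F ⊆ positiveInvariants τ ∧
      Ideal.span (F : Set (MvPolynomial ι ℂ)) = hilbertIdeal τ ∧ F.card = n := by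
    have hfg : (hilbertIdeal τ).FG := IsNoetherian.noetherian _
    obtain ⟨F, hF, hspan⟩ := (Submodule.fg_span_iff_fg_span_finset_subset _).mp hfg
    exact ⟨_, F, hF, hspan.symm, rfl⟩
  obtain ⟨F, hF, hspan, hcard⟩ := Nat.find_spec hex
  refine ⟨F, hF, hspan, fun p hp hmem => ?_⟩
  refine Nat.find_min hex (m := (F.erase p).card) ?_ ⟨F.erase p, ?_, ?_, rfl⟩
  · rw [← hcard]; exact Finset.card_erase_lt_of_mem hp
  · exact (Finset.coe_subset.mpr (Finset.erase_subset p F)).trans hF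
  · rw [← hspan, Finset.coe_erase]
    refine le_antisymm (Ideal.span_mono Set.sdiff_subset) (Ideal.span_le.mpr fun q hq => ?_)
    by_cases hqp : q = p
    · rw [hqp]; exact hmem
    · exact Ideal.subset_span ⟨hq, hqp⟩

theorem aeval_mem_invariantSubalgebra {κ : Type*} {f : κ → MvPolynomial ι ℂ}
    (hf : ∀ i, f i ∈ invariantSubalgebra τ) (h : MvPolynomial κ ℂ) :
    aeval f h ∈ invariantSubalgebra τ := by
  have hmem : aeval f h ∈ Algebra.adjoin ℂ (Set.range f) := by
    rw [Algebra.adjoin_range_eq_range_aeval]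
    exact ⟨h, rfl⟩
  exact Algebra.adjoin_le (by rintro _ ⟨i, rfl⟩; exact hf i) hmem

variable [Fintype G]

theorem adjoin_eq_invariantSubalgebra {F : Finset (MvPolynomial ι ℂ)}
    (hF : ↑F ⊆ positiveInvariants τ)
    (hspan : Ideal.span (F : Set (MvPolynomial ι ℂ)) = hilbertIdeal τ) :
    Algebra.adjoin ℂ (F : Set (MvPolynomial ι ℂ)) = invariantSubalgebra τ := by
  refine le_antisymm (Algebra.adjoin_le fun p hp => (hF hp).1) ?_
  have key : ∀ (n : ℕ) (p : MvPolynomial ι ℂ), p ∈ invariantSubalgebra τ → p.IsHomogeneous n →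
      p ∈ Algebra.adjoin ℂ (F : Set (MvPolynomial ι ℂ)) := by
    intro n
    induction n using Nat.strong_induction_on with
    | _ n ih =>
      intro p hp hn
      rcases Nat.eq_zero_or_pos n with rfl | hpos
      · rw [← homogeneousComponent_eq_self hn, homogeneousComponent_zero]
        exact Subalgebra.algebraMap_mem _ _
      · have hmem : p ∈ Ideal.span (F : Set (MvPolynomial ι ℂ)) := by
          rw [hspan]; exact Ideal.subset_span ⟨hp, n, hpos, hn⟩
        obtain ⟨a, ha⟩ := Submodule.mem_span_finset'.mp hmem
        have hp' : p =
            ∑ q : F, homogeneousComponent n (reynolds τ (a q) * (q : MvPolynomial ι ℂ)) := by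
          rw [← map_sum, ← homogeneousComponent_eq_self hn]
          conv_lhs => rw [← reynolds_of_mem hp, ← ha]
          simp only [map_sum, smul_eq_mul]
          congr 1
          funext q
          rw [reynolds_mul _ (hF q.2).1]
        rw [hp']
        refine sum_mem fun q _ => ?_
        obtain ⟨d, hd, hqd⟩ := (hF q.2).2
        rw [homogeneousComponent_mul_of_isHomogeneous hqd]
        split_ifs with hdn
        · exact mul_mem (ih (n - d) (by omega) _
            (homogeneousComponent_mem_invariantSubalgebra (reynolds_mem _) _)
            (homogeneousComponent_isHomogeneous _ _)) (Algebra.subset_adjoin q.2)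
        · exact zero_mem _
  intro p hp
  rw [← sum_homogeneousComponent p]
  exact sum_mem fun k _ => key k _ (homogeneousComponent_mem_invariantSubalgebra hp k)
    (homogeneousComponent_isHomogeneous _ _)

theorem algebraicIndependent_of_minimal_generators
    (hgen : Subgroup.closure {g : G | FixesHyperplane τ g} = ⊤)
    {F : Finset (MvPolynomial ι ℂ)} (hF : ↑F ⊆ positiveInvariants τ)
    (hspan : Ideal.span (F : Set (MvPolynomial ι ℂ)) = hilbertIdeal τ)
    (hmin : ∀ p ∈ F, p ∉ Ideal.span ((F : Set (MvPolynomial ι ℂ)) \ {p})) :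
    AlgebraicIndependent ℂ (Subtype.val : F → MvPolynomial ι ℂ) := by
  classical
  by_contra hdep
  have hinv : ∀ i : F, (i : MvPolynomial ι ℂ) ∈ invariantSubalgebra τ := fun i => (hF i.2).1
  choose e he hhom using fun i : F => (hF i.2).2
  obtain ⟨h, n, hw, hrel, i₁, hi₁⟩ := exists_minimal_relation hhom he hdep
  set H : F → MvPolynomial ι ℂ := fun j => aeval (Subtype.val : F → _) (pderiv j h) with hH
  have hHinv : ∀ j, H j ∈ invariantSubalgebra τ := fun j => aeval_mem_invariantSubalgebra hinv _
  have hHhom : ∀ j, ∃ d, (H j).IsHomogeneous d := by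
    intro j
    rcases le_or_gt (e j) n with hj | hj
    · exact ⟨n - e j, isHomogeneous_aeval_of_isWeightedHomogeneous hhom (hw.pderiv (by omega))⟩
    · refine ⟨0, ?_⟩
      rw [hH]
      simp only [pderiv_eq_zero_of_isWeightedHomogeneous hw hj, map_zero]
      exact isHomogeneous_zero _ _ _
  obtain ⟨B, hB, hBmin⟩ : ∃ B : Finset F, (∀ j, H j ∈ Ideal.span (H '' B)) ∧
      ∀ i ∈ B, H i ∉ Ideal.span (H '' (B.erase i)) := by
    have hex : ∃ n, ∃ B : Finset F, (∀ j, H j ∈ Ideal.span (H '' B)) ∧ B.card = n :=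
      ⟨_, Finset.univ, fun j => Ideal.subset_span ⟨j, by simp, rfl⟩, rfl⟩
    obtain ⟨B, hB, hcard⟩ := Nat.find_spec hex
    refine ⟨B, hB, fun i hi hmem => Nat.find_min hex (m := (B.erase i).card) ?_
      ⟨B.erase i, fun j => ?_, rfl⟩⟩
    · rw [← hcard]; exact Finset.card_erase_lt_of_mem hi
    · refine (Ideal.span_le.mpr ?_) (hB j)
      rintro _ ⟨k, hk, rfl⟩
      by_cases hki : k = i
      · rw [hki]; exact hmem
      · exact Ideal.subset_span ⟨k, by simpa [hki] using hk, rfl⟩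
  obtain ⟨i₀, hi₀⟩ : B.Nonempty := by
    by_contra hne
    rw [Finset.not_nonempty_iff_eq_empty] at hne
    have := hB i₁
    rw [hne] at this
    simp only [Finset.coe_empty, Set.image_empty, Ideal.span_empty, Ideal.mem_bot] at this
    exact hi₁ this
  set 𝔥 : Ideal (MvPolynomial ι ℂ) := Ideal.span (H '' (B.erase i₀)) with h𝔥
  have hcoef : ∀ j, ∃ c : MvPolynomial ι ℂ, (j = i₀ → c = 1) ∧ H j - c * H i₀ ∈ 𝔥 := by
    intro j
    by_cases hj : j = i₀
    · exact ⟨1, fun _ => rfl, by simp [hj]⟩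
    · have hmem := hB j
      rw [← Finset.insert_erase hi₀, Finset.coe_insert, Set.image_insert_eq,
        Ideal.mem_span_insert] at hmem
      obtain ⟨a, z, hz, hz'⟩ := hmem
      refine ⟨a, fun h => absurd h hj, ?_⟩
      rw [hz', add_sub_cancel_left]
      exact hz
  choose c hc1 hc using hcoef
  have hpk : ∀ k, ∑ j, c j * pderiv k (j : MvPolynomial ι ℂ) ∈ hilbertIdeal τ := by
    intro k
    obtain ⟨d₀, hd₀⟩ := hHhom i₀
    refine mem_hilbertIdeal_of_mul_mem hgen (H := H '' (B.erase i₀)) ?_ ?_ (hHinv i₀) hd₀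
      (hBmin i₀ hi₀) ?_
    · rintro _ ⟨j, _, rfl⟩; exact hHinv j
    · rintro _ ⟨j, _, rfl⟩; exact hHhom j
    · have hzero : ∑ j, H j * pderiv k (j : MvPolynomial ι ℂ) = 0 := by
        rw [← derivation_aeval, hrel, map_zero]
      have hmem : ∑ j, (H j - c j * H i₀) * pderiv k (j : MvPolynomial ι ℂ) ∈ 𝔥 :=
        sum_mem fun j _ => Ideal.mul_mem_right _ _ (hc j)
      simp only [sub_mul, Finset.sum_sub_distrib, hzero, zero_sub, neg_mem_iff] at hmem
      rw [Finset.sum_mul]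
      convert hmem using 2 with j
      ring
  have hpk' : ∀ k, ∃ a : F → MvPolynomial ι ℂ,
      ∑ j, a j * (j : MvPolynomial ι ℂ) = ∑ j, c j * pderiv k (j : MvPolynomial ι ℂ) := by
    intro k
    have := hpk k
    rw [← hspan] at this
    exact Submodule.mem_span_finset'.mp this
  choose a ha using hpk'
  have hsum : ∑ j : F, (e j • c j - ∑ k, X k * a k j) * (j : MvPolynomial ι ℂ) = 0 := by
    have h1 : ∑ k, X k * ∑ j : F, c j * pderiv k (j : MvPolynomial ι ℂ) =
        ∑ j : F, (e j • c j) * (j : MvPolynomial ι ℂ) := by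
      simp only [Finset.mul_sum]
      rw [Finset.sum_comm]
      refine Finset.sum_congr rfl fun j _ => ?_
      rw [smul_mul_assoc, ← mul_smul_comm, ← (hhom j).sum_X_mul_pderiv, Finset.mul_sum]
      exact Finset.sum_congr rfl fun k _ => by ring
    have h2 : ∑ k, X k * ∑ j : F, c j * pderiv k (j : MvPolynomial ι ℂ) =
        ∑ j : F, (∑ k, X k * a k j) * (j : MvPolynomial ι ℂ) := by
      simp only [← ha, Finset.mul_sum, Finset.sum_mul]
      rw [Finset.sum_comm]
      simp only [mul_assoc]
    simp only [sub_mul, Finset.sum_sub_distrib]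
    rw [← h1, h2, sub_self]
  have hcomp := congrArg (homogeneousComponent (e i₀)) hsum
  rw [map_sum, map_zero, ← Finset.add_sum_erase _ _ (Finset.mem_univ i₀),
    homogeneousComponent_mul_of_isHomogeneous (hhom i₀), if_pos le_rfl, Nat.sub_self,
    homogeneousComponent_zero, hc1 i₀ rfl] at hcomp
  have hcoeff : coeff 0 (e i₀ • (1 : MvPolynomial ι ℂ) - ∑ k, X k * a k i₀) = (e i₀ : ℂ) := by
    rw [← constantCoeff_eq]
    simp
  rw [hcoeff] at hcomp
  have hrest : ∑ j ∈ Finset.univ.erase i₀, homogeneousComponent (e i₀)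
      ((e j • c j - ∑ k, X k * a k j) * (j : MvPolynomial ι ℂ)) ∈
      Ideal.span ((F : Set (MvPolynomial ι ℂ)) \ {(i₀ : MvPolynomial ι ℂ)}) := by
    refine sum_mem fun j hj => ?_
    rw [homogeneousComponent_mul_of_isHomogeneous (hhom j)]
    split_ifs
    · refine Ideal.mul_mem_left _ _ (Ideal.subset_span ⟨j.2, fun h => ?_⟩)
      exact Finset.ne_of_mem_erase hj (Subtype.ext h)
    · exact zero_mem _
  refine hmin i₀ i₀.2 ?_
  have hmem := neg_mem hrest
  rw [← eq_neg_of_add_eq_zero_left hcomp] at hmem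
  have := Ideal.mul_mem_left _ (C (e i₀ : ℂ)⁻¹) hmem
  rwa [← mul_assoc, ← C_mul, inv_mul_cancel₀ (Nat.cast_ne_zero.mpr (he i₀).ne'), C_1,
    one_mul] at this

/-- Chevalley's theorem: the invariants of a finite group generated by reflections form a
polynomial algebra on homogeneous generators of positive degree. -/
theorem exists_basic_invariants (hgen : Subgroup.closure {g : G | FixesHyperplane τ g} = ⊤) :
    ∃ (m : ℕ) (f : Fin m → MvPolynomial ι ℂ) (e : Fin m → ℕ),
      (∀ i, 0 < e i) ∧ (∀ i, (f i).IsHomogeneous (e i)) ∧ AlgebraicIndependent ℂ f ∧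
      (aeval f : MvPolynomial (Fin m) ℂ →ₐ[ℂ] MvPolynomial ι ℂ).range =
        invariantSubalgebra τ := by
  obtain ⟨F, hF, hspan, hmin⟩ := exists_minimal_generators τ
  choose e he hhom using fun i : F => (hF i.2).2
  let φ := F.equivFin.symm
  refine ⟨F.card, fun i => φ i, fun i => e (φ i), fun i => he _, fun i => hhom _, ?_, ?_⟩
  · exact (algebraicIndependent_of_minimal_generators hgen hF hspan hmin).comp φ φ.injective
  · rw [← adjoin_eq_invariantSubalgebra hF hspan, ← Algebra.adjoin_range_eq_range_aeval]
    congr 1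
    ext p
    exact ⟨fun ⟨i, hi⟩ => hi ▸ (φ i).2, fun hp => ⟨φ.symm ⟨p, hp⟩, by simp⟩⟩

end Chevalley

end Solomon

namespace Solomon

open MvPolynomial

section Monomials

variable {κ : Type*}

/-- The basis of monomials of weight `n`. -/
noncomputable def monomialBasis (w : κ → ℕ) (n : ℕ) :
    Basis {d : κ →₀ ℕ // Finsupp.weight w d = n} ℂ (weightedHomogeneousSubmodule ℂ w n) :=
  Basis.mk (v := fun d => ⟨monomial d.1 1, isWeightedHomogeneous_monomial w _ _ d.2⟩)
    (LinearIndependent.of_comp (weightedHomogeneousSubmodule ℂ w n).subtype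
      ((basisMonomials κ ℂ).linearIndependent.comp Subtype.val Subtype.val_injective))
    (by
      rintro ⟨p, hp⟩ -
      have hsum : (⟨p, hp⟩ : weightedHomogeneousSubmodule ℂ w n) = ∑ d ∈ p.support.attach,
          coeff d.1 p • ⟨monomial d.1 1, isWeightedHomogeneous_monomial w _ _
            (hp (mem_support_iff.1 d.2))⟩ := by
        apply Subtype.ext
        rw [AddSubmonoidClass.coe_finsetSum]
        refine p.as_sum.trans ?_
        rw [← Finset.sum_attach]
        exact Finset.sum_congr rfl fun d _ => by simp [smul_monomial]
      rw [hsum]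
      exact Submodule.sum_mem _ fun d _ => Submodule.smul_mem _ _
        (Submodule.subset_span ⟨⟨d.1, hp (mem_support_iff.1 d.2)⟩, rfl⟩))

theorem monomialBasis_apply (w : κ → ℕ) (n : ℕ)
    (d : {d : κ →₀ ℕ // Finsupp.weight w d = n}) :
    (monomialBasis w n d : MvPolynomial κ ℂ) = monomial d.1 1 := by
  simp [monomialBasis]

variable [Fintype κ]

theorem finite_weightedHomogeneousSubmodule {w : κ → ℕ} (hw : ∀ i, 0 < w i) (n : ℕ) :
    Module.Finite ℂ (weightedHomogeneousSubmodule ℂ w n) :=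
  Module.Finite.iff_fg.2 (weightedHomogeneousSubmodule_fg ℂ w (fun i => (hw i).ne') n)

instance finite_homogeneousSubmodule (n : ℕ) :
    Module.Finite ℂ (homogeneousSubmodule κ ℂ n) :=
  finite_weightedHomogeneousSubmodule (fun _ => one_pos) n

theorem mk_dvd_mul_one_sub {e : ℕ} (he : 0 < e) :
    (PowerSeries.mk fun k => if e ∣ k then (1 : ℂ) else 0) * (1 - PowerSeries.X ^ e) = 1 := by
  ext n
  rw [mul_sub, mul_one, map_sub, PowerSeries.coeff_mul_X_pow', PowerSeries.coeff_mk,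
    PowerSeries.coeff_one]
  rcases Nat.eq_zero_or_pos n with rfl | hn
  · simp [he.ne']
  · by_cases hen : e ≤ n
    · simp only [hen, hn.ne', if_true, if_false, PowerSeries.coeff_mk,
        Nat.dvd_sub_iff_left hen (dvd_refl e), sub_self]
    · have : ¬ e ∣ n := fun h => hen (Nat.le_of_dvd hn h)
      simp [hen, hn.ne', this]

theorem hilbertSeries_weighted {w : κ → ℕ} (hw : ∀ i, 0 < w i) :
    (PowerSeries.mk fun n => (finrank ℂ (weightedHomogeneousSubmodule ℂ w n) : ℂ)) *
      ∏ i, (1 - PowerSeries.X ^ w i) = 1 := by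
  classical
  have key : (PowerSeries.mk fun n => (finrank ℂ (weightedHomogeneousSubmodule ℂ w n) : ℂ)) =
      ∏ i, PowerSeries.mk fun k => if w i ∣ k then (1 : ℂ) else 0 := by
    ext n
    rw [PowerSeries.coeff_mk, PowerSeries.coeff_prod, finrank_eq_nat_card_basis (monomialBasis w n)]
    simp only [PowerSeries.coeff_mk, Finset.prod_ite_zero, Finset.prod_const_one,
      Finset.sum_boole, Finset.mem_univ, true_imp_iff]
    rw [← Nat.card_eq_finsetCard, Nat.cast_inj]
    refine Nat.card_congr ⟨fun d => ⟨Finsupp.equivFunOnFinite.symm fun i => w i * d.1 i, ?_⟩,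
      fun l => ⟨Finsupp.equivFunOnFinite.symm fun i => l.1 i / w i, ?_⟩, ?_, ?_⟩
    · have := d.2
      rw [Finsupp.weight_apply, Finsupp.sum_fintype _ _ (by simp)] at this
      simpa [mul_comm] using this
    · have := l.2
      simp only [Finset.mem_filter, Finset.mem_finsuppAntidiag] at this
      rw [Finsupp.weight_apply, Finsupp.sum_fintype _ _ (by simp)]
      refine Eq.trans ?_ this.1.1
      exact Finset.sum_congr rfl fun i _ => Nat.div_mul_cancel (this.2 i)
    · intro d
      ext i
      simp [Nat.mul_div_cancel_left _ (hw i)]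
    · intro l
      have := l.2
      simp only [Finset.mem_filter, Finset.mem_finsuppAntidiag] at this
      ext i
      simp [Nat.mul_div_cancel' (this.2 i)]
  rw [key, ← Finset.prod_mul_distrib]
  exact Finset.prod_eq_one fun i _ => mk_dvd_mul_one_sub (hw i)

end Monomials

section Diagonal

theorem trace_eq_sum_of_basis {M T : Type*} [AddCommGroup M] [Module ℂ M] [Fintype T]
    (b : Basis T ℂ M) {f : Module.End ℂ M} {c : T → ℂ} (h : ∀ i, f (b i) = c i • b i) :
    LinearMap.trace ℂ M f = ∑ i, c i := by
  classical
  rw [LinearMap.trace_eq_matrix_trace ℂ b, Matrix.trace]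
  exact Finset.sum_congr rfl fun i _ => by simp [LinearMap.toMatrix_apply, h]

theorem exists_basis_eigenvectors {V ι : Type*} [AddCommGroup V] [Module ℂ V]
    [FiniteDimensional ℂ V] [Fintype ι] (hι : Fintype.card ι = finrank ℂ V)
    {f : Module.End ℂ V} {k : ℕ} (hk : 0 < k) (hf : f ^ k = 1) :
    ∃ (b : Basis ι ℂ V) (c : ι → ℂ), ∀ i, f (b i) = c i • b i := by
  have hss : f.IsSemisimple := by
    refine Module.End.isSemisimple_of_squarefree_aeval_eq_zero
      (p := (Polynomial.X ^ k - 1 : Polynomial ℂ)) ?_ (by simp [hf])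
    exact (Polynomial.separable_X_pow_sub_C (1 : ℂ) (by exact_mod_cast hk.ne')
      one_ne_zero).squarefree
  have htop := hss.iSup_eigenspace_eq_top
  let T : Set V := {v | ∃ μ : ℂ, f v = μ • v}
  have hT : Submodule.span ℂ T = ⊤ := by
    rw [eq_top_iff, ← htop, iSup_le_iff]
    intro μ v hv
    exact Submodule.subset_span ⟨μ, Module.End.mem_eigenspace_iff.1 hv⟩
  obtain ⟨s, hsT, hspan, hli⟩ := exists_linearIndependent ℂ T
  let b := Basis.mk hli (by rw [Subtype.range_coe, hspan, hT])
  have : Fintype s := FiniteDimensional.fintypeBasisIndex b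
  let e : s ≃ ι := Fintype.equivOfCardEq (by rw [hι, finrank_eq_card_basis b])
  choose c hc using fun i : s => hsT i.2
  refine ⟨b.reindex e, fun i => c (e.symm i), fun i => ?_⟩
  simp [b, hc]

variable {ι : Type*} [Fintype ι]

/-- The linear substitution acting on the homogeneous polynomials of degree `n`. -/
noncomputable def homogeneousSubst (n : ℕ) (A : Matrix ι ι ℂ) :
    Module.End ℂ (homogeneousSubmodule ι ℂ n) :=
  (subst A).toLinearMap.restrict fun _ hp => isHomogeneous_subst A hp

theorem coe_homogeneousSubst (n : ℕ) (A : Matrix ι ι ℂ) (p : homogeneousSubmodule ι ℂ n) :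
    (homogeneousSubst n A p : MvPolynomial ι ℂ) = subst A p := rfl

theorem homogeneousSubst_mul (n : ℕ) (A B : Matrix ι ι ℂ) :
    homogeneousSubst n (A * B) = homogeneousSubst n B * homogeneousSubst n A :=
  LinearMap.ext fun p => Subtype.ext (subst_mul A B p)

variable [DecidableEq ι]

theorem homogeneousSubst_one (n : ℕ) : homogeneousSubst n (1 : Matrix ι ι ℂ) = 1 :=
  LinearMap.ext fun p => Subtype.ext (subst_one (p : MvPolynomial ι ℂ))

theorem subst_diagonal_monomial (c : ι → ℂ) (d : ι →₀ ℕ) :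
    subst (Matrix.diagonal c) (monomial d 1) = (∏ i, c i ^ d i) • monomial d 1 := by
  refine MvPolynomial.funext fun v => ?_
  rw [eval_subst, smul_eval, eval_monomial, eval_monomial, Finsupp.prod_fintype _ _ (by simp),
    Finsupp.prod_fintype _ _ (by simp)]
  simp [Matrix.mulVec_diagonal, mul_pow, Finset.prod_mul_distrib]

theorem trace_homogeneousSubst_diagonal (n : ℕ) (c : ι → ℂ) :
    LinearMap.trace ℂ _ (homogeneousSubst n (Matrix.diagonal c)) =
      PowerSeries.coeff n (∏ i, PowerSeries.mk fun k => c i ^ k) := by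
  have hfin := (Finsupp.finite_of_nat_weight_eq (1 : ι → ℕ) (fun _ => one_ne_zero) n)
  have : Fintype {d : ι →₀ ℕ // Finsupp.weight (1 : ι → ℕ) d = n} := hfin.fintype
  let b : Basis {d : ι →₀ ℕ // Finsupp.weight (1 : ι → ℕ) d = n} ℂ (homogeneousSubmodule ι ℂ n) :=
    monomialBasis 1 n
  rw [trace_eq_sum_of_basis b (c := fun d => ∏ i, c i ^ d.1 i), PowerSeries.coeff_prod]
  · simp only [PowerSeries.coeff_mk]
    refine (Finset.sum_subtype _ (fun d => ?_) fun d : ι →₀ ℕ => ∏ i, c i ^ d i).symm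
    rw [Finsupp.weight_apply, Finsupp.sum_fintype _ _ (by simp)]
    simp [Finset.mem_finsuppAntidiag]
  · intro d
    refine Subtype.ext ?_
    have hb : (b d : MvPolynomial ι ℂ) = monomial d.1 1 := monomialBasis_apply 1 n d
    rw [coe_homogeneousSubst, SetLike.val_smul, hb, subst_diagonal_monomial]

theorem exists_eq_mul_diagonal_mul {A : Matrix ι ι ℂ} {k : ℕ} (hk : 0 < k) (hA : A ^ k = 1) :
    ∃ (P Q : Matrix ι ι ℂ) (c : ι → ℂ), P * Q = 1 ∧ Q * P = 1 ∧
      A = P * Matrix.diagonal c * Q := by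
  obtain ⟨b, c, hb⟩ := exists_basis_eigenvectors (ι := ι) (f := Matrix.toLin' A)
    (by simp) hk (by rw [← Matrix.toLin'_pow, hA, Matrix.toLin'_one]; rfl)
  have h1 : (Pi.basisFun ℂ ι).toMatrix b * b.toMatrix (Pi.basisFun ℂ ι) = 1 :=
    Basis.toMatrix_mul_toMatrix_flip _ _
  have h2 : b.toMatrix (Pi.basisFun ℂ ι) * (Pi.basisFun ℂ ι).toMatrix b = 1 :=
    Basis.toMatrix_mul_toMatrix_flip _ _
  refine ⟨(Pi.basisFun ℂ ι).toMatrix b, b.toMatrix (Pi.basisFun ℂ ι), c, h1, h2, ?_⟩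
  have : A * (Pi.basisFun ℂ ι).toMatrix b = (Pi.basisFun ℂ ι).toMatrix b * Matrix.diagonal c := by
    ext i j
    have := congrFun (hb j) i
    simp only [Matrix.toLin'_apply, Matrix.mulVec, dotProduct, Pi.smul_apply, smul_eq_mul] at this
    simp [Matrix.mul_apply, Basis.toMatrix_apply, Matrix.diagonal_apply, this, mul_comm]
  rw [← this, Matrix.mul_assoc, h1, Matrix.mul_one]

theorem eval_charpolyRev_eq_det (A : Matrix ι ι ℂ) (t : ℂ) :
    A.charpolyRev.eval t = (1 - t • A).det := by
  rw [Matrix.charpolyRev, ← Polynomial.coe_evalRingHom, RingHom.map_det]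
  congr 1
  ext i j
  simp [Matrix.one_apply, apply_ite]
  ring

/-- The generating function of the traces on homogeneous polynomials. -/
theorem mk_trace_mul_charpolyRev {A : Matrix ι ι ℂ} {k : ℕ} (hk : 0 < k) (hA : A ^ k = 1) :
    (PowerSeries.mk fun n => LinearMap.trace ℂ _ (homogeneousSubst n A)) *
      (A.charpolyRev : PowerSeries ℂ) = 1 := by
  obtain ⟨P, Q, c, hPQ, hQP, rfl⟩ := exists_eq_mul_diagonal_mul hk hA
  have h1 : (PowerSeries.mk fun n =>
      LinearMap.trace ℂ _ (homogeneousSubst n (P * Matrix.diagonal c * Q))) =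
      ∏ i, PowerSeries.mk fun k => c i ^ k := by
    ext n
    rw [PowerSeries.coeff_mk, ← trace_homogeneousSubst_diagonal, homogeneousSubst_mul,
      homogeneousSubst_mul, LinearMap.trace_mul_comm, mul_assoc,
      ← homogeneousSubst_mul, hQP, homogeneousSubst_one, mul_one]
  have h2 : (P * Matrix.diagonal c * Q).charpolyRev =
      ∏ i, (1 - Polynomial.C (c i) * Polynomial.X) := by
    refine Polynomial.funext fun t => ?_
    have h3 : 1 - t • (P * Matrix.diagonal c * Q) =
        P * Matrix.diagonal (fun i => 1 - c i * t) * Q := by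
      have : Matrix.diagonal (fun i => 1 - c i * t) = 1 - t • Matrix.diagonal c := by
        ext i j
        by_cases hij : i = j <;> simp [hij, mul_comm]
      rw [this, Matrix.mul_sub, Matrix.sub_mul, Matrix.mul_one, hPQ]
      simp
    rw [eval_charpolyRev_eq_det, h3, Matrix.det_mul, Matrix.det_mul, Matrix.det_diagonal,
      mul_right_comm, ← Matrix.det_mul, hPQ, Matrix.det_one, one_mul, Polynomial.eval_prod]
    simp
  rw [h1, h2, ← Polynomial.coeToPowerSeries.ringHom_apply, map_prod, ← Finset.prod_mul_distrib]
  refine Finset.prod_eq_one fun i _ => ?_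
  ext n
  have : Polynomial.coeToPowerSeries.ringHom (1 - Polynomial.C (c i) * Polynomial.X) =
      (1 - PowerSeries.C (c i) * PowerSeries.X : PowerSeries ℂ) := by simp
  rw [this, mul_sub, mul_one, ← mul_assoc, map_sub]
  rcases n with _ | n
  · simp
  · rw [PowerSeries.coeff_succ_mul_X, mul_comm _ (PowerSeries.C _), PowerSeries.coeff_C_mul]
    simp [PowerSeries.coeff_one, pow_succ']

end Diagonal

end Solomon

namespace Solomon

section Enumeration

variable {ι : Type*} [LinearOrder ι]

/-- The increasing enumeration of a finite set of `p` elements. -/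
def enum {p : ℕ} (s : Set.powersetCard ι p) : Fin p ↪o ι := Set.powersetCard.ofFinEmbEquiv.symm s

theorem exists_enum_eq_iff {p : ℕ} (s : Set.powersetCard ι p) (i : ι) :
    (∃ a, enum s a = i) ↔ i ∈ (s : Finset ι) :=
  Set.powersetCard.mem_range_ofFinEmbEquiv_symm_iff_mem s i

@[to_additive]
theorem prod_enum {M : Type*} [CommMonoid M] {p : ℕ} (s : Set.powersetCard ι p) (F : ι → M) :
    ∏ a, F (enum s a) = ∏ i ∈ (s : Finset ι), F i := by
  have : (s : Finset ι) = Finset.univ.map (enum s).toEmbedding := by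
    ext i
    simp [← exists_enum_eq_iff]
  rw [this, Finset.prod_map]
  rfl

end Enumeration

section ExteriorTrace

variable {ι : Type*} [Fintype ι]

theorem sum_powersetCard_eq (p : ℕ) (F : Finset ι → ℂ) :
    ∑ s : Set.powersetCard ι p, F s = ∑ s ∈ Finset.powersetCard p Finset.univ, F s := by
  refine (Finset.sum_subtype _ (fun s => ?_) F).symm
  simp [Finset.mem_powersetCard, Set.powersetCard]

theorem sum_powersetCard_pow_mul_prod (c : ι → ℂ) (y : ℂ) :
    ∑ p ∈ Finset.range (Fintype.card ι + 1),
      (∑ s : Set.powersetCard ι p, ∏ i ∈ (s : Finset ι), c i) * y ^ p = ∏ i, (1 + y * c i) := by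
  rw [Finset.prod_one_add, Finset.sum_powerset, Finset.card_univ]
  refine Finset.sum_congr rfl fun p _ => ?_
  rw [sum_powersetCard_eq p fun s => ∏ i ∈ s, c i, Finset.sum_mul]
  refine Finset.sum_congr rfl fun s hs => ?_
  rw [Finset.prod_mul_distrib, Finset.prod_const, (Finset.mem_powersetCard.1 hs).2, mul_comm]

variable [LinearOrder ι]

/-- The generating function of the traces on exterior powers. -/
theorem sum_trace_exteriorPower {A : Matrix ι ι ℂ} {k : ℕ} (hk : 0 < k) (hA : A ^ k = 1) (y : ℂ) :
    ∑ p ∈ Finset.range (Fintype.card ι + 1),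
      LinearMap.trace ℂ _ (exteriorPower.map p (Matrix.toLin' A)) * y ^ p = (1 + y • A).det := by
  obtain ⟨b, c, hb⟩ := exists_basis_eigenvectors (ι := ι) (f := Matrix.toLin' A)
    (by simp) hk (by rw [← Matrix.toLin'_pow, hA, Matrix.toLin'_one]; rfl)
  have hdet : (1 + y • A).det = ∏ i, (1 + y * c i) := by
    rw [← LinearMap.det_toLin', ← LinearMap.det_toMatrix b, ← Matrix.det_diagonal]
    congr 1
    ext i j
    rw [LinearMap.toMatrix_apply, map_add, map_smul, Matrix.toLin'_one, LinearMap.add_apply,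
      LinearMap.smul_apply, hb]
    by_cases hij : i = j
    · simp [hij]
    · simp [hij]
  have htr : ∀ p, LinearMap.trace ℂ _ (exteriorPower.map p (Matrix.toLin' A)) =
      ∑ s : Set.powersetCard ι p, ∏ i ∈ (s : Finset ι), c i := by
    intro p
    refine trace_eq_sum_of_basis (b.exteriorPower p) fun s => ?_
    rw [exteriorPower.basis_apply, exteriorPower.map_apply_ιMulti_family]
    rw [show Matrix.toLin' A ∘ b = fun i => c i • b i from funext hb, ← prod_enum]
    exact (exteriorPower.ιMulti ℂ p).toMultilinearMap.map_smul_univ (fun a => c (enum s a))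
      fun a => b (enum s a)
  rw [hdet, ← sum_powersetCard_pow_mul_prod]
  simp only [htr]

end ExteriorTrace

end Solomon

namespace Solomon

open MvPolynomial

section GradedPieces

variable {ι G : Type*} [Fintype ι] [LinearOrder ι] [Group G] (τ : G →* Matrix ι ι ℂ)

/-- The action of `G` on homogeneous polynomials, twisted by a linear character. -/
noncomputable def twistedRep (χ : G →* ℂ) (n : ℕ) :
    Representation ℂ G (homogeneousSubmodule ι ℂ n) where
  toFun g := χ g • homogeneousSubst n (τ g⁻¹)
  map_one' := by simp [homogeneousSubst_one]
  map_mul' g h := by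
    rw [mul_inv_rev, map_mul, map_mul, homogeneousSubst_mul, smul_mul_smul_comm]

/-- The action of `G` on exterior powers. -/
noncomputable def exteriorRep (p : ℕ) : Representation ℂ G (⋀[ℂ]^p (ι → ℂ)) where
  toFun g := exteriorPower.map p (Matrix.toLin' (τ g))
  map_one' := by
    rw [map_one, Matrix.toLin'_one]
    exact exteriorPower.map_id
  map_mul' g h := by
    rw [map_mul, Matrix.toLin'_mul]
    exact exteriorPower.map_comp (Matrix.toLin' (τ h)) (Matrix.toLin' (τ g))

/-- The semi-invariant homogeneous polynomials of degree `n`. -/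
noncomputable def semiInvariants (χ : G →* ℂ) (n : ℕ) : Submodule ℂ (MvPolynomial ι ℂ) :=
  (twistedRep τ χ n).invariants.map (homogeneousSubmodule ι ℂ n).subtype

/-- The invariant differential forms of degree `p` with homogeneous coefficients of degree `n`. -/
noncomputable def invariantForms (p n : ℕ) :
    Submodule ℂ (⋀[ℂ]^p (ι → ℂ) →ₗ[ℂ] MvPolynomial ι ℂ) :=
  (Representation.invariants (V := ⋀[ℂ]^p (ι → ℂ) →ₗ[ℂ] homogeneousSubmodule ι ℂ n)
    (Representation.linHom (exteriorRep τ p) (twistedRep τ 1 n))).map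
    (LinearMap.compRight ℂ (homogeneousSubmodule ι ℂ n).subtype)

variable {τ}

theorem mem_semiInvariants {χ : G →* ℂ} {n : ℕ} {p : MvPolynomial ι ℂ} :
    p ∈ semiInvariants τ χ n ↔
      p.IsHomogeneous n ∧ ∀ g, subst (τ g) p = χ g • p := by
  have hχ : ∀ g, χ g * χ g⁻¹ = 1 := fun g => by rw [← map_mul, mul_inv_cancel, map_one]
  have hτ : ∀ g p, subst (τ g) (subst (τ g⁻¹) p) = p := fun g p => by
    rw [← subst_mul, ← map_mul, inv_mul_cancel, map_one, subst_one]
  constructor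
  · rintro ⟨⟨p, hp⟩, h, rfl⟩
    refine ⟨hp, fun g => ?_⟩
    have h2 : χ g • subst (τ g⁻¹) p = p := congrArg Subtype.val (h g)
    have h3 := congrArg (subst (τ g)) h2
    rw [map_smul, hτ] at h3
    exact h3.symm
  · rintro ⟨hp, h⟩
    refine ⟨⟨p, hp⟩, fun g => Subtype.ext ?_, rfl⟩
    change χ g • subst (τ g⁻¹) p = p
    rw [h, smul_smul, hχ, one_smul]

theorem mem_semiInvariants_one {n : ℕ} {p : MvPolynomial ι ℂ} :
    p ∈ semiInvariants τ 1 n ↔ p.IsHomogeneous n ∧ p ∈ invariantSubalgebra τ := by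
  rw [mem_semiInvariants]
  simp [mem_invariantSubalgebra]

theorem mem_invariantForms {p n : ℕ} {ω : ⋀[ℂ]^p (ι → ℂ) →ₗ[ℂ] MvPolynomial ι ℂ} :
    ω ∈ invariantForms τ p n ↔ (∀ x, (ω x).IsHomogeneous n) ∧
      ∀ g x, subst (τ g) (ω (exteriorPower.map p (Matrix.toLin' (τ g)) x)) = ω x := by
  have hτ : ∀ g p, subst (τ g) (subst (τ g⁻¹) p) = p := fun g p => by
    rw [← subst_mul, ← map_mul, inv_mul_cancel, map_one, subst_one]
  constructor
  · rintro ⟨ω, h, rfl⟩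
    refine ⟨fun x => (ω x).2, fun g x => ?_⟩
    have h2 : ((1 : ℂ) • subst (τ g⁻¹⁻¹) (ω (exteriorRep τ p g⁻¹⁻¹ x)) : MvPolynomial ι ℂ) = ω x :=
      congrArg Subtype.val (LinearMap.congr_fun (h g⁻¹) x)
    rw [inv_inv, one_smul] at h2
    exact h2
  · rintro ⟨hhom, h⟩
    refine ⟨ω.codRestrict (homogeneousSubmodule ι ℂ n) hhom, fun g => ?_, rfl⟩
    refine LinearMap.ext fun x => Subtype.ext ?_
    change (1 : ℂ) • subst (τ g⁻¹) (ω (exteriorRep τ p g⁻¹ x)) = ω x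
    rw [one_smul]
    exact h g⁻¹ x

variable (τ)

instance finite_semiInvariants (χ : G →* ℂ) (n : ℕ) : Module.Finite ℂ (semiInvariants τ χ n) := by
  unfold semiInvariants; infer_instance

variable [Fintype G]

theorem card_mul_finrank_semiInvariants (χ : G →* ℂ) (n : ℕ) :
    (Fintype.card G : ℂ) * finrank ℂ (semiInvariants τ χ n) =
      ∑ g, χ g⁻¹ * LinearMap.trace ℂ _ (homogeneousSubst n (τ g)) := by
  have hcard : (Nat.card G : ℂ) ≠ 0 := Nat.cast_ne_zero.2 Nat.card_pos.ne'
  have : Invertible (Nat.card G : ℂ) := invertibleOfNonzero hcard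
  have h := Representation.card_inv_mul_sum_char_eq_finrank (twistedRep τ χ n)
  rw [semiInvariants, Submodule.finrank_map_subtype_eq, ← h, ← Nat.card_eq_fintype_card,
    mul_inv_cancel_left₀ hcard, ← Equiv.sum_comp (Equiv.inv G)]
  refine Finset.sum_congr rfl fun g _ => ?_
  change LinearMap.trace ℂ _ (χ g⁻¹ • homogeneousSubst n (τ g⁻¹⁻¹)) = _
  rw [map_smul, inv_inv, smul_eq_mul]

theorem card_mul_finrank_invariantForms (p n : ℕ) :
    (Fintype.card G : ℂ) * finrank ℂ (invariantForms τ p n) =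
      ∑ g, LinearMap.trace ℂ _ (exteriorPower.map p (Matrix.toLin' (τ g))) *
        LinearMap.trace ℂ _ (homogeneousSubst n (τ g)) := by
  have hcard : (Nat.card G : ℂ) ≠ 0 := Nat.cast_ne_zero.2 Nat.card_pos.ne'
  have : Invertible (Nat.card G : ℂ) := invertibleOfNonzero hcard
  have h := Representation.card_inv_mul_sum_char_eq_finrank
    (V := ⋀[ℂ]^p (ι → ℂ) →ₗ[ℂ] homogeneousSubmodule ι ℂ n)
    (Representation.linHom (exteriorRep τ p) (twistedRep τ 1 n))
  have hinj : Function.Injective (LinearMap.compRight ℂ (M := ⋀[ℂ]^p (ι → ℂ))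
      (homogeneousSubmodule ι ℂ n).subtype) := fun a b hab =>
    LinearMap.ext fun x => Subtype.ext (LinearMap.congr_fun hab x)
  rw [invariantForms, ← (Submodule.equivMapOfInjective _ hinj _).finrank_eq, ← h,
    ← Nat.card_eq_fintype_card, mul_inv_cancel_left₀ hcard, ← Equiv.sum_comp (Equiv.inv G)]
  refine Finset.sum_congr rfl fun g _ => ?_
  rw [Representation.char_linHom]
  change LinearMap.trace ℂ _ (exteriorRep τ p g⁻¹⁻¹) *
    LinearMap.trace ℂ _ ((1 : ℂ) • homogeneousSubst n (τ g⁻¹⁻¹)) = _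
  rw [one_smul, inv_inv]
  rfl

end GradedPieces

end Solomon

namespace Solomon

section Series

variable {ι G : Type*} [Fintype ι] [LinearOrder ι] [Group G] [Fintype G] (τ : G →* Matrix ι ι ℂ)

/-- The series `∑ a g / det (1 - X * g)` attached to a class function `a`. -/
noncomputable def traceSeries (a : G → ℂ) : PowerSeries ℂ :=
  ∑ g, PowerSeries.C (a g) *
    PowerSeries.mk fun n => LinearMap.trace ℂ _ (homogeneousSubst n (τ g))

theorem card_mul_mk_finrank_semiInvariants (χ : G →* ℂ) :
    PowerSeries.C (Fintype.card G : ℂ) *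
      (PowerSeries.mk fun n => (finrank ℂ (semiInvariants τ χ n) : ℂ)) =
      traceSeries τ fun g => χ g⁻¹ := by
  ext n
  rw [PowerSeries.coeff_C_mul, PowerSeries.coeff_mk, card_mul_finrank_semiInvariants,
    traceSeries, map_sum]
  exact Finset.sum_congr rfl fun g _ => by rw [PowerSeries.coeff_C_mul, PowerSeries.coeff_mk]

theorem card_mul_mk_finrank_invariantForms (p : ℕ) :
    PowerSeries.C (Fintype.card G : ℂ) *
      (PowerSeries.mk fun n => (finrank ℂ (invariantForms τ p n) : ℂ)) =
      traceSeries τ fun g => LinearMap.trace ℂ _ (exteriorPower.map p (Matrix.toLin' (τ g))) := by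
  ext n
  rw [PowerSeries.coeff_C_mul, PowerSeries.coeff_mk, card_mul_finrank_invariantForms,
    traceSeries, map_sum]
  exact Finset.sum_congr rfl fun g _ => by rw [PowerSeries.coeff_C_mul, PowerSeries.coeff_mk]

theorem map_pow_card (g : G) : τ g ^ Fintype.card G = 1 := by
  rw [← map_pow, pow_card_eq_one, map_one]

theorem charpolyRev_ne_zero (A : Matrix ι ι ℂ) : A.charpolyRev ≠ 0 := fun h => by
  have := A.eval_charpolyRev
  rw [h] at this
  simp at this

/-- A power series identity for `traceSeries` amounts to a polynomial identity. -/
theorem traceSeries_mul_eq_iff [DecidableEq G] (a : G → ℂ) (D N : Polynomial ℂ) :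
    traceSeries τ a * D = N ↔
      (∑ g, Polynomial.C (a g) * ∏ h ∈ Finset.univ.erase g, (τ h).charpolyRev) * D =
        N * ∏ h, (τ h).charpolyRev := by
  have hQ : ((∏ h, (τ h).charpolyRev : Polynomial ℂ) : PowerSeries ℂ) ≠ 0 := by
    rw [Ne, Polynomial.coe_eq_zero_iff]
    exact Finset.prod_ne_zero_iff.2 fun h _ => charpolyRev_ne_zero _
  have key : traceSeries τ a * ((∏ h, (τ h).charpolyRev : Polynomial ℂ) : PowerSeries ℂ) =
      ((∑ g, Polynomial.C (a g) * ∏ h ∈ Finset.univ.erase g, (τ h).charpolyRev : Polynomial ℂ) :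
        PowerSeries ℂ) := by
    rw [traceSeries, Finset.sum_mul, ← Polynomial.coeToPowerSeries.ringHom_apply (φ := ∑ g, _),
      map_sum]
    refine Finset.sum_congr rfl fun g _ => ?_
    rw [← Finset.mul_prod_erase _ _ (Finset.mem_univ g), Polynomial.coe_mul, mul_assoc,
      ← mul_assoc _ ((τ g).charpolyRev : PowerSeries ℂ),
      mk_trace_mul_charpolyRev Fintype.card_pos (map_pow_card τ g), one_mul, map_mul,
      Polynomial.coeToPowerSeries.ringHom_apply, Polynomial.coeToPowerSeries.ringHom_apply,
      Polynomial.coe_C]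
  rw [← mul_left_inj' hQ, mul_right_comm, key, ← Polynomial.coe_mul, ← Polynomial.coe_mul,
    Polynomial.coe_inj]

theorem eval_sum_mul_prod_erase [DecidableEq G] (a : G → ℂ) {t : ℂ}
    (ht : ∀ g, (1 - t • τ g).det ≠ 0) :
    (∑ g, Polynomial.C (a g) * ∏ h ∈ Finset.univ.erase g, (τ h).charpolyRev).eval t =
      (∑ g, a g / (1 - t • τ g).det) * (∏ h, (τ h).charpolyRev).eval t := by
  rw [Polynomial.eval_finsetSum, Finset.sum_mul]
  refine Finset.sum_congr rfl fun g _ => ?_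
  rw [← Finset.mul_prod_erase _ _ (Finset.mem_univ g), Polynomial.eval_mul, Polynomial.eval_mul,
    eval_charpolyRev_eq_det, Polynomial.eval_C, ← mul_assoc, div_mul_cancel₀ _ (ht g)]

theorem eval_prod_charpolyRev_ne_zero {t : ℂ} (ht : ∀ g, (1 - t • τ g).det ≠ 0) :
    (∏ h, (τ h).charpolyRev).eval t ≠ 0 := by
  rw [Polynomial.eval_prod, Finset.prod_ne_zero_iff]
  intro g _
  rw [eval_charpolyRev_eq_det]
  exact ht g

/-- Evaluation of a power series identity for `traceSeries`. -/
theorem eval_traceSeries {a : G → ℂ} {D N : Polynomial ℂ} (h : traceSeries τ a * D = N) {t : ℂ}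
    (ht : ∀ g, (1 - t • τ g).det ≠ 0) :
    (∑ g, a g / (1 - t • τ g).det) * D.eval t = N.eval t := by
  classical
  have h1 := congrArg (Polynomial.eval t) ((traceSeries_mul_eq_iff τ a D N).1 h)
  rw [Polynomial.eval_mul, Polynomial.eval_mul, eval_sum_mul_prod_erase τ a ht,
    mul_right_comm] at h1
  exact mul_right_cancel₀ (eval_prod_charpolyRev_ne_zero τ ht) h1

theorem traceSeries_mul_eq_of_eval {a : G → ℂ} {D N : Polynomial ℂ}
    (h : ∀ t : ℂ, t ≠ 0 → (∀ g, (1 - t • τ g).det ≠ 0) →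
      (∑ g, a g / (1 - t • τ g).det) * D.eval t = N.eval t) :
    traceSeries τ a * D = N := by
  classical
  rw [traceSeries_mul_eq_iff]
  have hQ : Polynomial.X * ∏ h, (τ h).charpolyRev ≠ 0 :=
    mul_ne_zero Polynomial.X_ne_zero (Finset.prod_ne_zero_iff.2 fun h _ => charpolyRev_ne_zero _)
  refine mul_right_cancel₀ hQ (Polynomial.funext fun t => ?_)
  rw [Polynomial.eval_mul, Polynomial.eval_mul (p := N * _)]
  by_cases h0 : (Polynomial.X * ∏ h, (τ h).charpolyRev).eval t = 0
  · rw [h0, mul_zero, mul_zero]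
  · congr 1
    rw [Polynomial.eval_mul, mul_eq_zero, not_or, Polynomial.eval_X, Polynomial.eval_prod,
      Finset.prod_eq_zero_iff] at h0
    have ht : ∀ g, (1 - t • τ g).det ≠ 0 := fun g hg =>
      h0.2 ⟨g, Finset.mem_univ g, by rw [eval_charpolyRev_eq_det, hg]⟩
    rw [Polynomial.eval_mul, Polynomial.eval_mul, eval_sum_mul_prod_erase τ a ht,
      mul_right_comm, h t h0.1 ht]

end Series

end Solomon

namespace Solomon

open MvPolynomial

section Jacobian

variable {ι G : Type*} [Fintype ι] [DecidableEq ι] [Group G]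

/-- The polynomials `f` are homogeneous generators, of degrees `e`, of the polynomial algebra of
invariants. -/
structure IsBasicInvariants (τ : G →* Matrix ι ι ℂ) (f : ι → MvPolynomial ι ℂ) (e : ι → ℕ) :
    Prop where
  pos : ∀ i, 0 < e i
  isHomogeneous : ∀ i, (f i).IsHomogeneous (e i)
  algebraicIndependent : AlgebraicIndependent ℂ f
  range_eq : (aeval f : MvPolynomial ι ℂ →ₐ[ℂ] MvPolynomial ι ℂ).range = invariantSubalgebra τ

/-- The Jacobian matrix of a family of polynomials. -/
noncomputable def jacobianMatrix (f : ι → MvPolynomial ι ℂ) : Matrix ι ι (MvPolynomial ι ℂ) :=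
  Matrix.of fun i j => pderiv j (f i)

theorem isIntegral_invariantSubalgebra [Finite G] (τ : G →* Matrix ι ι ℂ) :
    Algebra.IsIntegral (invariantSubalgebra τ) (MvPolynomial ι ℂ) := by
  let _ : MulSemiringAction G (MvPolynomial ι ℂ) :=
    { smul := fun g p => subst (τ g⁻¹) p
      one_smul := fun p => by
        change subst (τ 1⁻¹) p = p
        rw [inv_one, map_one, subst_one]
      mul_smul := fun g h p => by
        change subst (τ (g * h)⁻¹) p = subst (τ g⁻¹) (subst (τ h⁻¹) p)
        rw [mul_inv_rev, map_mul, subst_mul]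
      smul_zero := fun g => map_zero (subst (τ g⁻¹))
      smul_add := fun g => map_add (subst (τ g⁻¹))
      smul_one := fun g => map_one (subst (τ g⁻¹))
      smul_mul := fun g => map_mul (subst (τ g⁻¹)) }
  have : Algebra.IsInvariant (invariantSubalgebra τ) (MvPolynomial ι ℂ) G :=
    ⟨fun p hp => ⟨⟨p, fun g => by
      have : subst (τ g⁻¹⁻¹) p = p := hp g⁻¹
      rwa [inv_inv] at this⟩, rfl⟩⟩
  exact Algebra.IsInvariant.isIntegral (invariantSubalgebra τ) (MvPolynomial ι ℂ) G

/-- The number of basic invariants is the number of variables. -/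
theorem exists_isBasicInvariants [Fintype G] {τ : G →* Matrix ι ι ℂ}
    (hgen : Subgroup.closure {g : G | FixesHyperplane τ g} = ⊤) :
    ∃ f e, IsBasicInvariants τ f e := by
  obtain ⟨m, f, e, he, hf, hind, hrange⟩ := exists_basic_invariants hgen
  have hadj : Algebra.adjoin ℂ (Set.range f) = invariantSubalgebra τ := by
    rw [← hrange, Algebra.adjoin_range_eq_range_aeval]
  have hbasis : IsTranscendenceBasis ℂ f := by
    rw [hind.isTranscendenceBasis_iff_isAlgebraic, hadj]
    have := isIntegral_invariantSubalgebra τ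
    infer_instance
  have hcard := hbasis.lift_cardinalMk_eq (IsTranscendenceBasis.mvPolynomial ι ℂ)
  obtain ⟨φ⟩ := Cardinal.lift_mk_eq'.1 hcard
  refine ⟨f ∘ φ.symm, e ∘ φ.symm, fun i => he _, fun i => hf _, hind.comp _ φ.symm.injective, ?_⟩
  rw [← Algebra.adjoin_range_eq_range_aeval, φ.symm.surjective.range_comp, hadj]

theorem derivation_eq_zero_of_isAlgebraic {R S : Type*} [CommRing R] [IsDomain R] [CharZero R]
    [CommRing S] [IsDomain S] [Algebra R S] [FaithfulSMul R S] [Algebra.IsAlgebraic R S]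
    (D : Derivation R S S) : D = 0 := by
  refine Derivation.ext fun s => ?_
  obtain ⟨P, ⟨hP0, hP⟩, hmin⟩ := WellFounded.has_min
    (InvImage.wf (Polynomial.natDegree (R := R)) wellFounded_lt)
    {P : Polynomial R | P ≠ 0 ∧ Polynomial.aeval s P = 0} (Algebra.IsAlgebraic.isAlgebraic s)
  have hdeg : P.natDegree ≠ 0 := fun h => by
    rw [Polynomial.natDegree_eq_zero] at h
    obtain ⟨c, rfl⟩ := h
    rw [Polynomial.aeval_C, FaithfulSMul.algebraMap_eq_zero_iff] at hP
    exact hP0 (by rw [hP, map_zero])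
  have hder : Polynomial.aeval s (Polynomial.derivative P) ≠ 0 := fun h =>
    hmin _ ⟨fun h0 => hdeg (Polynomial.derivative_eq_zero.1 h0), h⟩
      (Polynomial.natDegree_derivative_lt hdeg)
  have h := D.map_aeval P s
  rw [hP, map_zero, smul_eq_mul, eq_comm, mul_eq_zero] at h
  exact h.resolve_left hder

theorem IsBasicInvariants.det_jacobianMatrix_ne_zero [Finite G] {τ : G →* Matrix ι ι ℂ}
    {f : ι → MvPolynomial ι ℂ} {e : ι → ℕ} (hf : IsBasicInvariants τ f e) :
    (jacobianMatrix f).det ≠ 0 := by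
  intro h0
  obtain ⟨v, hv0, hv⟩ := Matrix.exists_mulVec_eq_zero_iff.2 h0
  have hθ : ∀ i, mkDerivation ℂ v (f i) = 0 := fun i => by
    have h1 := derivation_aeval (f := X) (mkDerivation ℂ v) (f i)
    simp only [aeval_X_left_apply, mkDerivation_X] at h1
    rw [h1]
    exact congrFun hv i
  let θ : Derivation (invariantSubalgebra τ) (MvPolynomial ι ℂ) (MvPolynomial ι ℂ) :=
    { toFun := mkDerivation ℂ v
      map_add' := map_add _
      map_smul' := fun r p => by
        have hr : mkDerivation ℂ v (r : MvPolynomial ι ℂ) = 0 := by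
          obtain ⟨h, hh⟩ : (r : MvPolynomial ι ℂ) ∈
              (aeval f : MvPolynomial ι ℂ →ₐ[ℂ] MvPolynomial ι ℂ).range := by
            rw [hf.range_eq]
            exact r.2
          rw [← hh]
          change mkDerivation ℂ v (aeval f h) = 0
          rw [derivation_aeval]
          simp [hθ]
        change mkDerivation ℂ v ((r : MvPolynomial ι ℂ) * p) =
          (r : MvPolynomial ι ℂ) * mkDerivation ℂ v p
        rw [Derivation.leibniz, hr, smul_zero, add_zero, smul_eq_mul]
      map_one_eq_zero' := Derivation.map_one_eq_zero _
      leibniz' := Derivation.leibniz _ }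
  have := isIntegral_invariantSubalgebra τ
  refine hv0 (_root_.funext fun j => ?_)
  have h1 : θ (X j) = 0 := by rw [derivation_eq_zero_of_isAlgebraic θ]; rfl
  rw [← mkDerivation_X (R := ℂ) v j]
  exact h1

end Jacobian

end Solomon

namespace Solomon

open MvPolynomial

section SemiInvariants

theorem isHomogeneous_det {σ κ : Type*} [Fintype κ] [DecidableEq κ]
    {M : Matrix κ κ (MvPolynomial σ ℂ)} {c : κ → ℕ} (h : ∀ i j, (M i j).IsHomogeneous (c i)) :
    M.det.IsHomogeneous (∑ i, c i) := by
  rw [← Matrix.det_transpose, Matrix.det_apply]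
  refine IsHomogeneous.sum _ _ _ fun s _ => ?_
  rw [Units.smul_def, ← Int.cast_smul_eq_zsmul ℂ, smul_eq_C_mul]
  exact (IsHomogeneous.prod _ _ _ fun i _ => h _ _).C_mul _

theorem pderiv_eq_subst {ι : Type*} [Fintype ι] [DecidableEq ι] {A : Matrix ι ι ℂ}
    {p : MvPolynomial ι ℂ} (hp : subst A p = p) (j : ι) :
    pderiv j p = ∑ k, C (A k j) * subst A (pderiv k p) := by
  have h := dirDeriv_subst A (Pi.single j 1) p
  rw [hp, dirDeriv_apply, dirDeriv_apply, map_sum] at h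
  simpa [Pi.single_apply, smul_eq_C_mul, ← algebraMap_eq] using h

theorem coe_prod_one_sub_X_pow {ι : Type*} [Fintype ι] (e : ι → ℕ) :
    ((∏ i, (1 - Polynomial.X ^ e i) : Polynomial ℂ) : PowerSeries ℂ) =
      ∏ i, (1 - PowerSeries.X ^ e i) := by
  rw [← Polynomial.coeToPowerSeries.ringHom_apply, map_prod]
  simp

theorem C_card_ne_zero (G : Type*) [Fintype G] [Nonempty G] :
    PowerSeries.C (Fintype.card G : ℂ) ≠ 0 :=
  (map_ne_zero_iff _ PowerSeries.C_injective).2 (Nat.cast_ne_zero.2 Fintype.card_ne_zero)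

variable {ι G : Type*} [Fintype ι] [LinearOrder ι] [Group G] {τ : G →* Matrix ι ι ℂ}

variable (τ) in
/-- The character by which the Jacobian of the basic invariants transforms. -/
noncomputable def detInv : G →* ℂ where
  toFun g := (τ g⁻¹).det
  map_one' := by simp
  map_mul' g h := by rw [mul_inv_rev, map_mul, Matrix.det_mul, mul_comm]

theorem det_mul_detInv (g : G) : (τ g).det * detInv τ g = 1 := by
  change (τ g).det * (τ g⁻¹).det = 1
  rw [← Matrix.det_mul, ← map_mul, mul_inv_cancel, map_one, Matrix.det_one]

variable {f : ι → MvPolynomial ι ℂ} {e : ι → ℕ}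

theorem IsBasicInvariants.mem_invariantSubalgebra (hf : IsBasicInvariants τ f e) (i : ι) :
    f i ∈ invariantSubalgebra τ := by
  rw [← hf.range_eq]
  exact ⟨X i, aeval_X f i⟩

theorem IsBasicInvariants.jacobianMatrix_eq (hf : IsBasicInvariants τ f e) (g : G) :
    jacobianMatrix f = (jacobianMatrix f).map (subst (τ g)) * (τ g).map C := by
  ext1 i j
  rw [Matrix.mul_apply]
  simp only [Matrix.map_apply, jacobianMatrix, Matrix.of_apply]
  rw [pderiv_eq_subst (hf.mem_invariantSubalgebra i g) j]
  exact Finset.sum_congr rfl fun k _ => mul_comm _ _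

theorem IsBasicInvariants.det_jacobianMatrix_mem (hf : IsBasicInvariants τ f e) :
    (jacobianMatrix f).det ∈ semiInvariants τ (detInv τ) (∑ i, (e i - 1)) := by
  rw [mem_semiInvariants]
  refine ⟨isHomogeneous_det fun i j => (hf.isHomogeneous i).pderiv, fun g => ?_⟩
  have h := congrArg Matrix.det (hf.jacobianMatrix_eq g)
  rw [Matrix.det_mul] at h
  have h1 : ((jacobianMatrix f).map (subst (τ g))).det = subst (τ g) (jacobianMatrix f).det :=
    ((subst (τ g)).map_det _).symm
  have h2 : ((τ g).map (C : ℂ → MvPolynomial ι ℂ)).det = C (τ g).det :=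
    ((C : ℂ →+* MvPolynomial ι ℂ).map_det _).symm
  rw [h1, h2] at h
  conv_rhs => rw [h, smul_eq_C_mul, mul_left_comm, ← C_mul, mul_comm (detInv τ g), det_mul_detInv,
    C_1, mul_one]

theorem IsBasicInvariants.mk_finrank_mul (hf : IsBasicInvariants τ f e) :
    (PowerSeries.mk fun n => (finrank ℂ (semiInvariants τ 1 n) : ℂ)) *
      ∏ i, (1 - PowerSeries.X ^ e i) = 1 := by
  suffices h : ∀ n, finrank ℂ (semiInvariants τ 1 n) =
      finrank ℂ (weightedHomogeneousSubmodule ℂ e n) by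
    simp only [h]
    exact hilbertSeries_weighted hf.pos
  intro n
  have hinj : Function.Injective (aeval f : MvPolynomial ι ℂ →ₐ[ℂ] _).toLinearMap :=
    hf.algebraicIndependent
  have h : semiInvariants τ 1 n = (weightedHomogeneousSubmodule ℂ e n).map
      (aeval f : MvPolynomial ι ℂ →ₐ[ℂ] MvPolynomial ι ℂ).toLinearMap := by
    ext p
    rw [mem_semiInvariants_one, ← hf.range_eq]
    constructor
    · rintro ⟨hp, h, rfl⟩
      refine ⟨weightedHomogeneousComponent e n h,
        weightedHomogeneousComponent_isWeightedHomogeneous _ _, ?_⟩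
      exact (homogeneousComponent_aeval hf.isHomogeneous h n).symm.trans
        (homogeneousComponent_eq_self hp)
    · rintro ⟨h, hh, rfl⟩
      exact ⟨isHomogeneous_aeval_of_isWeightedHomogeneous hf.isHomogeneous hh, h, rfl⟩
  rw [h, ← (Submodule.equivMapOfInjective _ hinj _).finrank_eq]

theorem det_one_sub_inv_smul {t : ℂ} (ht : t ≠ 0) (g : G) :
    (τ g).det * (-t) ^ Fintype.card ι * (1 - t⁻¹ • τ g⁻¹).det = (1 - t • τ g).det := by
  rw [mul_comm (τ g).det, ← Matrix.det_smul, ← Matrix.det_mul]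
  congr 1
  rw [mul_sub, mul_one, smul_mul_smul_comm, ← map_mul, mul_inv_cancel, map_one, neg_mul,
    mul_inv_cancel₀ ht]
  module

variable [Fintype G]

/-- Molien's formula. -/
theorem IsBasicInvariants.molien (hf : IsBasicInvariants τ f e) {t : ℂ}
    (ht : ∀ g, (1 - t • τ g).det ≠ 0) :
    (∑ g, 1 / (1 - t • τ g).det) * ∏ i, (1 - t ^ e i) = Fintype.card G := by
  have h : traceSeries τ (fun g => (1 : G →* ℂ) g⁻¹) *
      ((∏ i, (1 - Polynomial.X ^ e i) : Polynomial ℂ) : PowerSeries ℂ) =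
      (Polynomial.C (Fintype.card G : ℂ) : Polynomial ℂ) := by
    rw [← card_mul_mk_finrank_semiInvariants, coe_prod_one_sub_X_pow, mul_assoc,
      hf.mk_finrank_mul, mul_one, Polynomial.coe_C]
  simpa [Polynomial.eval_prod] using eval_traceSeries τ h ht

theorem IsBasicInvariants.molien_det (hf : IsBasicInvariants τ f e) {t : ℂ} (ht0 : t ≠ 0)
    (ht : ∀ g, (1 - t • τ g).det ≠ 0) :
    (∑ g, (τ g).det / (1 - t • τ g).det) * ∏ i, (1 - t ^ e i) =
      Fintype.card G * t ^ ∑ i, (e i - 1) := by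
  have h1 : ∀ g, (1 - t⁻¹ • τ g).det ≠ 0 := fun g h => ht g⁻¹ (by
    rw [← det_one_sub_inv_smul ht0, inv_inv, h, mul_zero])
  have h2 := hf.molien h1
  rw [← Equiv.sum_comp (Equiv.inv G)] at h2
  have h3 : ∀ g, 1 / (1 - t⁻¹ • τ g⁻¹).det =
      ((τ g).det / (1 - t • τ g).det) * (-t) ^ Fintype.card ι := fun g => by
    have h4 := ht g
    rw [← det_one_sub_inv_smul ht0] at h4 ⊢
    have h5 := left_ne_zero_of_mul h4
    have := left_ne_zero_of_mul h5
    have := right_ne_zero_of_mul h5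
    have := right_ne_zero_of_mul h4
    field_simp
  simp only [Equiv.inv_apply, h3] at h2
  rw [← h2, ← Finset.sum_mul, mul_assoc, mul_assoc, ← Finset.prod_pow_eq_pow_sum,
    ← Finset.card_univ, ← Finset.prod_const, ← Finset.prod_mul_distrib,
    ← Finset.prod_mul_distrib]
  congr 1
  refine Finset.prod_congr rfl fun i _ => ?_
  obtain ⟨k, hk⟩ := Nat.exists_eq_add_of_lt (hf.pos i)
  rw [hk, zero_add, Nat.add_sub_cancel, inv_pow]
  field_simp
  ring

theorem IsBasicInvariants.mk_finrank_semiInvariants_detInv (hf : IsBasicInvariants τ f e) :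
    (PowerSeries.mk fun n => (finrank ℂ (semiInvariants τ (detInv τ) n) : ℂ)) =
      (PowerSeries.mk fun n => (finrank ℂ (semiInvariants τ 1 n) : ℂ)) *
        PowerSeries.X ^ ∑ i, (e i - 1) := by
  have h : traceSeries τ (fun g => detInv τ g⁻¹) *
      ((∏ i, (1 - Polynomial.X ^ e i) : Polynomial ℂ) : PowerSeries ℂ) =
      (Polynomial.C (Fintype.card G : ℂ) * Polynomial.X ^ ∑ i, (e i - 1) : Polynomial ℂ) :=
    traceSeries_mul_eq_of_eval τ fun t ht0 ht => by
      simpa [Polynomial.eval_prod, detInv] using hf.molien_det ht0 ht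
  rw [← card_mul_mk_finrank_semiInvariants, coe_prod_one_sub_X_pow, mul_assoc, Polynomial.coe_mul,
    Polynomial.coe_C, Polynomial.coe_pow, Polynomial.coe_X, mul_right_inj' (C_card_ne_zero G)] at h
  have h1 := hf.mk_finrank_mul
  rw [← h, mul_left_comm, h1, mul_one]

theorem IsBasicInvariants.eq_zero_of_lt (hf : IsBasicInvariants τ f e) {n : ℕ}
    (hn : n < ∑ i, (e i - 1)) {p : MvPolynomial ι ℂ} (hp : p ∈ semiInvariants τ (detInv τ) n) :
    p = 0 := by
  have h := congrArg (PowerSeries.coeff n) hf.mk_finrank_semiInvariants_detInv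
  rw [PowerSeries.coeff_mul_X_pow', PowerSeries.coeff_mk, if_neg (by omega), Nat.cast_eq_zero,
    Submodule.finrank_eq_zero] at h
  rwa [h, Submodule.mem_bot] at hp

theorem IsBasicInvariants.exists_eq_det_mul (hf : IsBasicInvariants τ f e) {n : ℕ}
    {p : MvPolynomial ι ℂ} (hp : p ∈ semiInvariants τ (detInv τ) (n + ∑ i, (e i - 1))) :
    ∃ r ∈ semiInvariants τ 1 n, p = (jacobianMatrix f).det * r := by
  have h := congrArg (PowerSeries.coeff (n + ∑ i, (e i - 1))) hf.mk_finrank_semiInvariants_detInv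
  rw [PowerSeries.coeff_mul_X_pow, PowerSeries.coeff_mk, PowerSeries.coeff_mk, Nat.cast_inj] at h
  have hinj : Function.Injective (LinearMap.mulLeft ℂ (jacobianMatrix f).det) :=
    mul_right_injective₀ hf.det_jacobianMatrix_ne_zero
  have hJ := mem_semiInvariants.1 hf.det_jacobianMatrix_mem
  have hle : (semiInvariants τ 1 n).map (LinearMap.mulLeft ℂ (jacobianMatrix f).det) ≤
      semiInvariants τ (detInv τ) (n + ∑ i, (e i - 1)) := by
    rintro _ ⟨r, hr, rfl⟩
    have hr := mem_semiInvariants_one.1 hr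
    refine mem_semiInvariants.2 ⟨?_, fun g => ?_⟩
    · rw [add_comm]
      exact hJ.1.mul hr.1
    · rw [LinearMap.mulLeft_apply, map_mul, hJ.2, hr.2, smul_mul_assoc]
  have heq := Submodule.eq_of_le_of_finrank_eq hle
    (((Submodule.equivMapOfInjective _ hinj _).finrank_eq).symm.trans h.symm)
  rw [← heq] at hp
  obtain ⟨r, hr, rfl⟩ := hp
  exact ⟨r, hr, rfl⟩

end SemiInvariants

end Solomon

namespace Solomon

open MvPolynomial

section Expansion

variable {ι R : Type*} [Fintype ι] [CommRing R] {p : ℕ}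

/-- Expansion of an alternating map on coordinate vectors. -/
theorem map_eq_sum_single [DecidableEq ι] {M : Type*} [AddCommGroup M] [Module R M]
    (F : (ι → R) [⋀^Fin p]→ₗ[R] M) (x : Fin p → ι → R) :
    F x = ∑ k : Fin p → ι, (∏ a, x a (k a)) • F fun a => Pi.single (k a) 1 := by
  have h : x = fun a => ∑ j, x a j • (Pi.single j 1 : ι → R) := by
    funext a j
    simp [Pi.single_apply]
  conv_lhs => rw [h]
  exact (F.toMultilinearMap.map_sum _).trans
    (Finset.sum_congr rfl fun k _ => F.toMultilinearMap.map_smul_univ _ _)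

end Expansion

section ReplaceRows

variable {ι R : Type*} [LinearOrder ι] {p : ℕ}

/-- The matrix `M` with the rows in `I` replaced by given vectors. -/
noncomputable def replaceRows (M : Matrix ι ι R) (I : Set.powersetCard ι p) (x : Fin p → ι → R) :
    Matrix ι ι R :=
  Matrix.of fun i j => Function.extend (enum I) (fun a => x a j) (fun i => M i j) i

theorem replaceRows_enum (M : Matrix ι ι R) (I : Set.powersetCard ι p) (x : Fin p → ι → R)
    (a : Fin p) (j : ι) : replaceRows M I x (enum I a) j = x a j := by
  rw [replaceRows, Matrix.of_apply, (enum I).injective.extend_apply]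

theorem replaceRows_of_notMem (M : Matrix ι ι R) {I : Set.powersetCard ι p} (x : Fin p → ι → R)
    {i : ι} (hi : i ∉ (I : Finset ι)) (j : ι) : replaceRows M I x i j = M i j := by
  rw [replaceRows, Matrix.of_apply, Function.extend_apply' _ _ _ (by rwa [exists_enum_eq_iff])]

theorem matrix_ext_enum {M N : Matrix ι ι R} (I : Set.powersetCard ι p)
    (h : ∀ a j, M (enum I a) j = N (enum I a) j)
    (h' : ∀ i ∉ (I : Finset ι), ∀ j, M i j = N i j) : M = N := by
  ext i j
  by_cases hi : i ∈ (I : Finset ι)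
  · obtain ⟨a, rfl⟩ := (exists_enum_eq_iff I i).2 hi
    exact h a j
  · exact h' i hi j

theorem enum_mem (I : Set.powersetCard ι p) (a : Fin p) : enum I a ∈ (I : Finset ι) :=
  (exists_enum_eq_iff I _).1 ⟨a, rfl⟩

theorem replaceRows_update (M : Matrix ι ι R) (I : Set.powersetCard ι p) (x : Fin p → ι → R)
    (a : Fin p) (v : ι → R) :
    replaceRows M I (Function.update x a v) = (replaceRows M I x).updateRow (enum I a) v := by
  refine matrix_ext_enum I (fun b j => ?_) fun i hi j => ?_
  · rw [replaceRows_enum]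
    by_cases hb : b = a
    · subst hb
      simp
    · rw [Function.update_of_ne hb, Matrix.updateRow_ne ((enum I).injective.ne hb),
        replaceRows_enum]
  · rw [replaceRows_of_notMem _ _ hi,
      Matrix.updateRow_ne (ne_of_mem_of_not_mem (enum_mem I a) hi).symm,
      replaceRows_of_notMem _ _ hi]

variable [Fintype ι] [CommRing R]

/-- The determinant of a matrix as an alternating function of some of its rows. -/
noncomputable def rowsDet (M : Matrix ι ι R) (I : Set.powersetCard ι p) :
    (ι → R) [⋀^Fin p]→ₗ[R] R where
  toFun x := (replaceRows M I x).det
  map_update_add' x a v w := by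
    have : ‹DecidableEq (Fin p)› = instDecidableEqFin p := Subsingleton.elim _ _
    subst this
    simp only [replaceRows_update, Matrix.det_updateRow_add]
  map_update_smul' x a c v := by
    have : ‹DecidableEq (Fin p)› = instDecidableEqFin p := Subsingleton.elim _ _
    subst this
    simp only [replaceRows_update, Matrix.det_updateRow_smul, smul_eq_mul]
  map_eq_zero_of_eq' x a b hab hne :=
    Matrix.det_zero_of_row_eq ((enum I).injective.ne hne)
      (funext fun j => by rw [replaceRows_enum, replaceRows_enum, hab])

theorem rowsDet_apply (M : Matrix ι ι R) (I : Set.powersetCard ι p) (x : Fin p → ι → R) :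
    rowsDet M I x = (replaceRows M I x).det := rfl

theorem rowsDet_self (M : Matrix ι ι R) (I : Set.powersetCard ι p) :
    rowsDet M I (fun a => M (enum I a)) = M.det := by
  rw [rowsDet_apply]
  congr 1
  exact matrix_ext_enum I (fun a j => replaceRows_enum _ _ _ _ _)
    fun i hi j => replaceRows_of_notMem _ _ hi _

theorem rowsDet_of_ne (M : Matrix ι ι R) {I I' : Set.powersetCard ι p} (h : I ≠ I') :
    rowsDet M I (fun a => M (enum I' a)) = 0 := by
  have hcard : (I : Finset ι).card = (I' : Finset ι).card := I.2.trans I'.2.symm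
  obtain ⟨i, hi', hi⟩ : ∃ i ∈ (I' : Finset ι), i ∉ (I : Finset ι) := by
    by_contra! hsub
    exact h (Subtype.ext (Finset.eq_of_subset_of_card_le hsub hcard.le).symm)
  obtain ⟨a, rfl⟩ := (exists_enum_eq_iff I' i).2 hi'
  refine Matrix.det_zero_of_row_eq (i := enum I a) (j := enum I' a)
    (ne_of_mem_of_not_mem (enum_mem I a) hi) (funext fun j => ?_)
  rw [replaceRows_enum, replaceRows_of_notMem _ _ hi]

theorem rowsDet_mul_det (M B : Matrix ι ι R) (I : Set.powersetCard ι p) (x : Fin p → ι → R) :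
    rowsDet M I x * B.det = rowsDet (M * B) I fun a => Matrix.vecMul (x a) B := by
  rw [rowsDet_apply, rowsDet_apply, ← Matrix.det_mul]
  congr 1
  refine matrix_ext_enum I (fun a j => ?_) fun i hi j => ?_
  · simp only [replaceRows_enum, Matrix.mul_apply, Matrix.vecMul, dotProduct]
  · simp only [replaceRows_of_notMem _ _ hi, Matrix.mul_apply]

theorem map_rowsDet {S : Type*} [CommRing S] (φ : R →+* S) (M : Matrix ι ι R)
    (I : Set.powersetCard ι p) (x : Fin p → ι → R) :
    φ (rowsDet M I x) = rowsDet (M.map φ) I fun a j => φ (x a j) := by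
  rw [rowsDet_apply, rowsDet_apply, RingHom.map_det]
  congr 1
  refine matrix_ext_enum I (fun a j => ?_) fun i hi j => ?_
  · simp [replaceRows_enum]
  · simp [replaceRows_of_notMem _ _ hi]

theorem isHomogeneous_rowsDet {σ : Type*} {M : Matrix ι ι (MvPolynomial σ ℂ)} {c : ι → ℕ}
    (hM : ∀ i j, (M i j).IsHomogeneous (c i)) (I : Set.powersetCard ι p)
    {x : Fin p → ι → MvPolynomial σ ℂ} (hx : ∀ a j, (x a j).IsHomogeneous 0) :
    (rowsDet M I x).IsHomogeneous (∑ i ∈ (I : Finset ι)ᶜ, c i) := by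
  have h : ∑ i ∈ (I : Finset ι)ᶜ, c i = ∑ i, if i ∈ (I : Finset ι)ᶜ then c i else 0 := by
    rw [Finset.sum_ite_mem, Finset.univ_inter]
  rw [h, rowsDet_apply]
  refine isHomogeneous_det fun i j => ?_
  by_cases hi : i ∈ (I : Finset ι)
  · obtain ⟨a, rfl⟩ := (exists_enum_eq_iff I i).2 hi
    rw [if_neg (by simpa using hi), replaceRows_enum]
    exact hx _ _
  · rw [if_pos (by simpa using hi), replaceRows_of_notMem _ _ hi]
    exact hM _ _

end ReplaceRows

end Solomon

namespace Solomon

open MvPolynomial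

section BasicForms

variable {ι : Type*} {p : ℕ}

theorem isHomogeneous_of_ιMulti {ω : ⋀[ℂ]^p (ι → ℂ) →ₗ[ℂ] MvPolynomial ι ℂ} {n : ℕ}
    (h : ∀ v, (ω (exteriorPower.ιMulti ℂ p v)).IsHomogeneous n) (x : ⋀[ℂ]^p (ι → ℂ)) :
    (ω x).IsHomogeneous n := by
  have hle : Submodule.span ℂ (Set.range (exteriorPower.ιMulti ℂ p (M := ι → ℂ))) ≤
      (homogeneousSubmodule ι ℂ n).comap ω := by
    rw [Submodule.span_le]
    rintro _ ⟨v, rfl⟩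
    exact h v
  rw [exteriorPower.ιMulti_span] at hle
  exact hle (Submodule.mem_top (x := x))

theorem factorial_smul_ne_zero {q : MvPolynomial ι ℂ} (hq : q ≠ 0) : p.factorial • q ≠ 0 :=
  smul_ne_zero p.factorial_ne_zero hq

variable [Fintype ι] [LinearOrder ι]

/-- The vector of differentials `v ↦ (d f_i v)`, for `i` in `I`, at a constant vector field. -/
noncomputable def differential (f : ι → MvPolynomial ι ℂ) (I : Set.powersetCard ι p) :
    (ι → ℂ) →ₗ[ℂ] (Fin p → MvPolynomial ι ℂ) :=
  LinearMap.pi fun a => Fintype.linearCombination ℂ fun j => pderiv j (f (enum I a))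

theorem differential_apply (f : ι → MvPolynomial ι ℂ) (I : Set.powersetCard ι p) (v : ι → ℂ)
    (a : Fin p) : differential f I v a = dirDeriv v (f (enum I a)) := by
  rw [dirDeriv_apply]
  rfl

/-- The differential form obtained as the wedge product of the `d f_i`, for `i` in `I`. -/
noncomputable def basicForm (f : ι → MvPolynomial ι ℂ) (I : Set.powersetCard ι p) :
    ⋀[ℂ]^p (ι → ℂ) →ₗ[ℂ] MvPolynomial ι ℂ :=
  exteriorPower.alternatingMapLinearEquiv
    (AlternatingMap.compLinearMap
      { (Matrix.detRowAlternating (n := Fin p)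
          (R := MvPolynomial ι ℂ)).toMultilinearMap.restrictScalars ℂ with
        map_eq_zero_of_eq' := fun v _ _ hab hne =>
          Matrix.detRowAlternating.map_eq_zero_of_eq v hab hne }
      (differential f I))

theorem basicForm_ιMulti (f : ι → MvPolynomial ι ℂ) (I : Set.powersetCard ι p)
    (v : Fin p → ι → ℂ) :
    basicForm f I (exteriorPower.ιMulti ℂ p v) =
      (Matrix.of fun b a => dirDeriv (v b) (f (enum I a))).det := by
  rw [basicForm, exteriorPower.alternatingMapLinearEquiv_apply_ιMulti]
  change Matrix.det (Matrix.of fun b => differential f I (v b)) = _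
  congr 1
  ext1 b a
  exact differential_apply f I (v b) a

theorem dirDeriv_single (j : ι) (q : MvPolynomial ι ℂ) :
    dirDeriv (Pi.single j 1) q = pderiv j q := by
  simp [dirDeriv_apply, Pi.single_apply]

/-- The coefficients, up to a common factor, of a form with respect to the basic forms. -/
noncomputable def formCoeff (f : ι → MvPolynomial ι ℂ) (p : ℕ) :
    (⋀[ℂ]^p (ι → ℂ) →ₗ[ℂ] MvPolynomial ι ℂ) →ₗ[MvPolynomial ι ℂ]
      (Set.powersetCard ι p → MvPolynomial ι ℂ) where
  toFun ω I := ∑ k : Fin p → ι, ω (exteriorPower.ιMulti ℂ p fun a => Pi.single (k a) 1) *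
    rowsDet (jacobianMatrix f) I fun a => Pi.single (k a) 1
  map_add' ω ω' := by
    funext I
    simp only [LinearMap.add_apply, add_mul, Finset.sum_add_distrib, Pi.add_apply]
  map_smul' c ω := by
    funext I
    simp only [LinearMap.smul_apply, smul_eq_mul, mul_assoc, Finset.mul_sum, Pi.smul_apply,
      RingHom.id_apply]

theorem formCoeff_apply (f : ι → MvPolynomial ι ℂ)
    (ω : ⋀[ℂ]^p (ι → ℂ) →ₗ[ℂ] MvPolynomial ι ℂ) (I : Set.powersetCard ι p) :
    formCoeff f p ω I =
      ∑ k : Fin p → ι, ω (exteriorPower.ιMulti ℂ p fun a => Pi.single (k a) 1) *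
        rowsDet (jacobianMatrix f) I fun a => Pi.single (k a) 1 := rfl

theorem formCoeff_basicForm_eq (f : ι → MvPolynomial ι ℂ) (I I' : Set.powersetCard ι p) :
    formCoeff f p (basicForm f I') I =
      p.factorial • rowsDet (jacobianMatrix f) I fun a => jacobianMatrix f (enum I' a) := by
  set M := jacobianMatrix f with hM
  have h1 : ∀ k : Fin p → ι,
      basicForm f I' (exteriorPower.ιMulti ℂ p fun a => Pi.single (k a) 1) =
        ∑ s : Equiv.Perm (Fin p), Equiv.Perm.sign s • ∏ b, M (enum I' (s b)) (k b) := fun k => by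
    rw [basicForm_ιMulti, ← Matrix.det_transpose, Matrix.det_apply]
    simp only [Matrix.transpose_apply, Matrix.of_apply, dirDeriv_single, hM, jacobianMatrix]
  have h2 : ∀ s : Equiv.Perm (Fin p),
      ∑ k : Fin p → ι, (∏ b, M (enum I' (s b)) (k b)) *
        (rowsDet M I fun a => Pi.single (k a) 1) =
      Equiv.Perm.sign s • rowsDet M I fun a => M (enum I' a) := fun s => by
    rw [← AlternatingMap.map_perm]
    exact (map_eq_sum_single (rowsDet M I) _).symm
  rw [formCoeff_apply]
  simp only [h1, Finset.sum_mul]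
  rw [Finset.sum_comm]
  simp only [smul_mul_assoc, ← Finset.smul_sum]
  rw [← hM]
  simp only [h2, smul_smul, Int.units_mul_self, one_smul, Finset.sum_const, Finset.card_univ,
    Fintype.card_perm, Fintype.card_fin]

theorem formCoeff_linearCombination (f : ι → MvPolynomial ι ℂ)
    (r : Set.powersetCard ι p → MvPolynomial ι ℂ) :
    formCoeff f p (Fintype.linearCombination (MvPolynomial ι ℂ) (basicForm f) r) =
      (p.factorial • (jacobianMatrix f).det) • r := by
  funext I
  rw [Fintype.linearCombination_apply, map_sum, Finset.sum_apply, Finset.sum_eq_single I]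
  · rw [map_smul, Pi.smul_apply, formCoeff_basicForm_eq, rowsDet_self, Pi.smul_apply, smul_eq_mul,
      smul_eq_mul, mul_comm]
  · intro I' _ hne
    rw [map_smul, Pi.smul_apply, formCoeff_basicForm_eq, rowsDet_of_ne _ hne.symm, smul_zero,
      smul_zero]
  · intro h
    exact absurd (Finset.mem_univ I) h

theorem linearCombination_basicForm_injective {f : ι → MvPolynomial ι ℂ}
    (hJ : (jacobianMatrix f).det ≠ 0) :
    Function.Injective (Fintype.linearCombination (MvPolynomial ι ℂ) (basicForm f (p := p))) := by
  intro r r' h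
  have h1 := congrArg (formCoeff f p) h
  rw [formCoeff_linearCombination, formCoeff_linearCombination] at h1
  exact smul_right_injective _ (factorial_smul_ne_zero hJ) h1

theorem formCoeff_injective {f : ι → MvPolynomial ι ℂ} (hJ : (jacobianMatrix f).det ≠ 0) :
    Function.Injective (formCoeff f p) := by
  let T : (Set.powersetCard ι p → MvPolynomial ι ℂ) ≃ₗ[MvPolynomial ι ℂ]
      (⋀[ℂ]^p (ι → ℂ) →ₗ[ℂ] MvPolynomial ι ℂ) :=
    ((Pi.basisFun ℂ ι).exteriorPower p).constr (MvPolynomial ι ℂ)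
  let Lmat := LinearMap.toMatrix' (formCoeff f p ∘ₗ T.toLinearMap)
  let Umat := LinearMap.toMatrix'
    (T.symm.toLinearMap ∘ₗ Fintype.linearCombination (MvPolynomial ι ℂ) (basicForm f (p := p)))
  have hmul : Lmat * Umat = (p.factorial • (jacobianMatrix f).det) • 1 := by
    rw [← LinearMap.toMatrix'_comp, ← LinearMap.toMatrix'_one, ← map_smul]
    congr 1
    refine LinearMap.ext fun r => ?_
    simp [formCoeff_linearCombination]
  have hdet : Lmat.det ≠ 0 := by
    refine left_ne_zero_of_mul (b := Umat.det) ?_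
    rw [← Matrix.det_mul, hmul, Matrix.det_smul, Matrix.det_one, mul_one]
    exact pow_ne_zero _ (factorial_smul_ne_zero hJ)
  rw [injective_iff_map_eq_zero]
  intro ω hω
  have h0 : T.symm ω = 0 := by
    refine Matrix.eq_zero_of_mulVec_eq_zero hdet ?_
    rw [LinearMap.toMatrix'_mulVec]
    simp [hω]
  simpa using h0

end BasicForms

end Solomon

namespace Solomon

open MvPolynomial

section InvariantForms

variable {ι G : Type*} [Fintype ι] [LinearOrder ι] [Group G] {τ : G →* Matrix ι ι ℂ} {p : ℕ}
  {f : ι → MvPolynomial ι ℂ} {e : ι → ℕ}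

theorem IsBasicInvariants.basicForm_mem (hf : IsBasicInvariants τ f e)
    (I : Set.powersetCard ι p) :
    basicForm f I ∈ invariantForms τ p (∑ i ∈ (I : Finset ι), (e i - 1)) := by
  rw [mem_invariantForms]
  refine ⟨isHomogeneous_of_ιMulti fun v => ?_, fun g x => ?_⟩
  · rw [basicForm_ιMulti, ← Matrix.det_transpose, ← sum_enum]
    exact isHomogeneous_det fun a b => isHomogeneous_dirDeriv _ (hf.isHomogeneous _)
  · have h : (subst (τ g)).toLinearMap ∘ₗ basicForm f I ∘ₗ
        exteriorPower.map p (Matrix.toLin' (τ g)) = basicForm f I := by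
      refine exteriorPower.linearMap_ext (AlternatingMap.ext fun v => ?_)
      simp only [LinearMap.compAlternatingMap_apply, LinearMap.comp_apply,
        exteriorPower.map_apply_ιMulti, basicForm_ιMulti, AlgHom.toLinearMap_apply,
        AlgHom.map_det]
      congr 1
      ext1 b a
      have h2 : subst (τ g) (f (enum I a)) = f (enum I a) := hf.mem_invariantSubalgebra _ g
      have h3 := dirDeriv_subst (τ g) (v b) (f (enum I a))
      rw [h2] at h3
      exact h3.symm
    exact LinearMap.congr_fun h x

theorem subst_apply_single_eq {n : ℕ} {ω : ⋀[ℂ]^p (ι → ℂ) →ₗ[ℂ] MvPolynomial ι ℂ}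
    (hω : ω ∈ invariantForms τ p n) (g : G) (k : Fin p → ι) :
    ω (exteriorPower.ιMulti ℂ p fun a => Pi.single (k a) 1) =
      ∑ l : Fin p → ι, (∏ a, C (τ g (l a) (k a))) *
        subst (τ g) (ω (exteriorPower.ιMulti ℂ p fun a => Pi.single (l a) 1)) := by
  rw [← (mem_invariantForms.1 hω).2 g, exteriorPower.map_apply_ιMulti]
  have h := map_eq_sum_single (ω.compAlternatingMap (exteriorPower.ιMulti ℂ p))
    (⇑(Matrix.toLin' (τ g)) ∘ fun a => Pi.single (k a) 1)
  simp only [LinearMap.compAlternatingMap_apply] at h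
  rw [h, map_sum]
  refine Finset.sum_congr rfl fun l _ => ?_
  rw [map_smul, smul_eq_C_mul, map_prod]
  simp

theorem IsBasicInvariants.rowsDet_jacobianMatrix_eq (hf : IsBasicInvariants τ f e) (g : G)
    (I : Set.powersetCard ι p) (l : Fin p → ι) :
    C (τ g).det * subst (τ g) (rowsDet (jacobianMatrix f) I fun a => Pi.single (l a) 1) =
      ∑ k : Fin p → ι, (∏ a, C (τ g (l a) (k a))) *
        rowsDet (jacobianMatrix f) I fun a => Pi.single (k a) 1 := by
  have h1 := map_rowsDet (subst (τ g) : MvPolynomial ι ℂ →+* MvPolynomial ι ℂ) (jacobianMatrix f) I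
    fun a => Pi.single (l a) 1
  have h2 : (fun (a : Fin p) (j : ι) => (subst (τ g) : MvPolynomial ι ℂ →+* MvPolynomial ι ℂ)
      ((Pi.single (l a) 1 : ι → MvPolynomial ι ℂ) j)) = fun a => Pi.single (l a) 1 := by
    funext a j
    by_cases hj : j = l a
    · subst hj; simp
    · simp [hj]
  have h3 : (fun a => Matrix.vecMul (Pi.single (l a) 1) ((τ g).map C)) =
      fun (a : Fin p) (j : ι) => (C (τ g (l a) j) : MvPolynomial ι ℂ) := by
    funext a j
    simp
  rw [h2] at h1
  simp only [RingHom.coe_coe] at h1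
  rw [h1, RingHom.map_det, mul_comm]
  change _ * ((τ g).map C).det = _
  rw [rowsDet_mul_det, ← hf.jacobianMatrix_eq, h3, map_eq_sum_single]
  rfl

theorem IsBasicInvariants.formCoeff_mem (hf : IsBasicInvariants τ f e) {n : ℕ}
    {ω : ⋀[ℂ]^p (ι → ℂ) →ₗ[ℂ] MvPolynomial ι ℂ} (hω : ω ∈ invariantForms τ p n)
    (I : Set.powersetCard ι p) :
    formCoeff f p ω I ∈ semiInvariants τ (detInv τ) (n + ∑ i ∈ (I : Finset ι)ᶜ, (e i - 1)) := by
  rw [mem_semiInvariants]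
  constructor
  · rw [formCoeff_apply]
    refine IsHomogeneous.sum _ _ _ fun k _ => ((mem_invariantForms.1 hω).1 _).mul ?_
    refine isHomogeneous_rowsDet (fun i j => (hf.isHomogeneous i).pderiv) I fun a j => ?_
    by_cases hj : j = k a
    · subst hj
      simpa using isHomogeneous_one ι ℂ
    · simpa [hj] using isHomogeneous_zero ι ℂ 0
  · intro g
    have h : C (τ g).det * subst (τ g) (formCoeff f p ω I) = formCoeff f p ω I := by
      rw [formCoeff_apply, map_sum, Finset.mul_sum]
      simp only [map_mul, mul_left_comm (C (τ g).det), hf.rowsDet_jacobianMatrix_eq g I]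
      rw [Finset.sum_congr rfl fun k _ => congrArg (· * _) (subst_apply_single_eq hω g k)]
      simp only [Finset.mul_sum, Finset.sum_mul]
      rw [Finset.sum_comm]
      exact Finset.sum_congr rfl fun k _ => Finset.sum_congr rfl fun l _ => by ring
    conv_rhs => rw [← h]
    rw [← smul_eq_C_mul, smul_smul, mul_comm, det_mul_detInv, one_smul]

end InvariantForms

end Solomon

namespace Solomon

open MvPolynomial

section FormSeries

variable {ι G : Type*} [Fintype ι] [LinearOrder ι] [Group G] (τ : G →* Matrix ι ι ℂ) (p : ℕ)
  (f : ι → MvPolynomial ι ℂ) (e : ι → ℕ)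

/-- The invariants of degree `n - k`. -/
noncomputable def shiftedInvariants (n k : ℕ) : Submodule ℂ (MvPolynomial ι ℂ) :=
  if k ≤ n then semiInvariants τ 1 (n - k) else ⊥

instance finite_shiftedInvariants (n k : ℕ) : Module.Finite ℂ (shiftedInvariants τ n k) := by
  by_cases h : k ≤ n
  · rw [shiftedInvariants, if_pos h]
    infer_instance
  · rw [shiftedInvariants, if_neg h]
    infer_instance

theorem mk_finrank_shiftedInvariants (k : ℕ) :
    (PowerSeries.mk fun n => (finrank ℂ (shiftedInvariants τ n k) : ℂ)) =
      PowerSeries.X ^ k * PowerSeries.mk fun n => (finrank ℂ (semiInvariants τ 1 n) : ℂ) := by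
  ext n
  rw [PowerSeries.coeff_X_pow_mul', PowerSeries.coeff_mk, PowerSeries.coeff_mk, shiftedInvariants]
  by_cases h : k ≤ n
  · rw [if_pos h, if_pos h]
  · rw [if_neg h, if_neg h, finrank_bot, Nat.cast_zero]

/-- The linear combinations of the basic forms with invariant coefficients. -/
noncomputable def combineForms (n : ℕ) :
    (∀ I : Set.powersetCard ι p, shiftedInvariants τ n (∑ i ∈ (I : Finset ι), (e i - 1))) →ₗ[ℂ]
      (⋀[ℂ]^p (ι → ℂ) →ₗ[ℂ] MvPolynomial ι ℂ) :=
  (Fintype.linearCombination (MvPolynomial ι ℂ) (basicForm f (p := p))).restrictScalars ℂ ∘ₗ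
    LinearMap.pi fun I => (Submodule.subtype _) ∘ₗ LinearMap.proj I

variable {τ p f e}

theorem combineForms_apply {n : ℕ}
    (r : ∀ I : Set.powersetCard ι p, shiftedInvariants τ n (∑ i ∈ (I : Finset ι), (e i - 1))) :
    combineForms τ p f e n r =
      Fintype.linearCombination (MvPolynomial ι ℂ) (basicForm f) fun I => (r I).1 := rfl

theorem combineForms_injective (hJ : (jacobianMatrix f).det ≠ 0) (n : ℕ) :
    Function.Injective (combineForms τ p f e n) := fun r r' h => by
  have h1 := linearCombination_basicForm_injective hJ h
  exact funext fun I => Subtype.ext (congrFun h1 I)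

theorem smul_mem_invariantForms {n k : ℕ} {r : MvPolynomial ι ℂ}
    {ω : ⋀[ℂ]^p (ι → ℂ) →ₗ[ℂ] MvPolynomial ι ℂ} (hr : r ∈ shiftedInvariants τ n k)
    (hω : ω ∈ invariantForms τ p k) : r • ω ∈ invariantForms τ p n := by
  rw [shiftedInvariants] at hr
  split_ifs at hr with h
  · rw [mem_semiInvariants_one, mem_invariantSubalgebra] at hr
    rw [mem_invariantForms] at hω ⊢
    refine ⟨fun x => ?_, fun g x => ?_⟩
    · have := hr.1.mul (hω.1 x)
      rwa [Nat.sub_add_cancel h] at this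
    · rw [LinearMap.smul_apply, LinearMap.smul_apply, smul_eq_mul, smul_eq_mul, map_mul, hr.2 g,
        hω.2 g]
  · rw [Submodule.mem_bot] at hr
    rw [hr, zero_smul]
    exact zero_mem _

variable [Fintype G]

theorem IsBasicInvariants.exists_formCoeff_eq (hf : IsBasicInvariants τ f e) {n : ℕ}
    {ω : ⋀[ℂ]^p (ι → ℂ) →ₗ[ℂ] MvPolynomial ι ℂ} (hω : ω ∈ invariantForms τ p n)
    (I : Set.powersetCard ι p) :
    ∃ r ∈ shiftedInvariants τ n (∑ i ∈ (I : Finset ι), (e i - 1)),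
      formCoeff f p ω I = (jacobianMatrix f).det * r := by
  have hmem := hf.formCoeff_mem hω I
  have hsum := Finset.sum_add_sum_compl (I : Finset ι) fun i => e i - 1
  rw [shiftedInvariants]
  split_ifs with h
  · refine hf.exists_eq_det_mul ?_
    rwa [← hsum, ← add_assoc, Nat.sub_add_cancel h]
  · refine ⟨0, zero_mem _, ?_⟩
    rw [mul_zero]
    exact hf.eq_zero_of_lt (by omega) hmem

theorem IsBasicInvariants.range_combineForms (hf : IsBasicInvariants τ f e) (n : ℕ) :
    LinearMap.range (combineForms τ p f e n) = invariantForms τ p n := by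
  refine le_antisymm ?_ fun ω hω => ?_
  · rintro _ ⟨r, rfl⟩
    rw [combineForms_apply, Fintype.linearCombination_apply]
    exact sum_mem fun I _ => smul_mem_invariantForms (r I).2 (hf.basicForm_mem I)
  · choose r hr hrω using fun I => hf.exists_formCoeff_eq hω I
    refine ⟨fun I => (p.factorial : ℂ)⁻¹ • ⟨r I, hr I⟩,
      formCoeff_injective hf.det_jacobianMatrix_ne_zero (funext fun I => ?_)⟩
    have hp : (p.factorial : ℂ) ≠ 0 := Nat.cast_ne_zero.2 p.factorial_ne_zero
    rw [combineForms_apply, formCoeff_linearCombination, hrω, Pi.smul_apply, smul_eq_mul,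
      ← Nat.cast_smul_eq_nsmul ℂ, Submodule.coe_smul, smul_mul_smul_comm, mul_inv_cancel₀ hp,
      one_smul]

theorem IsBasicInvariants.finrank_invariantForms (hf : IsBasicInvariants τ f e) (n : ℕ) :
    finrank ℂ (invariantForms τ p n) =
      ∑ I : Set.powersetCard ι p,
        finrank ℂ (shiftedInvariants τ n (∑ i ∈ (I : Finset ι), (e i - 1))) := by
  rw [← hf.range_combineForms, LinearMap.finrank_range_of_inj
    (combineForms_injective hf.det_jacobianMatrix_ne_zero n), finrank_pi_fintype]

theorem IsBasicInvariants.mk_finrank_invariantForms (hf : IsBasicInvariants τ f e) :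
    (PowerSeries.mk fun n => (finrank ℂ (invariantForms τ p n) : ℂ)) *
        ∏ i, (1 - PowerSeries.X ^ e i) =
      ∑ I : Set.powersetCard ι p, PowerSeries.X ^ ∑ i ∈ (I : Finset ι), (e i - 1) := by
  have h : (PowerSeries.mk fun n => (finrank ℂ (invariantForms τ p n) : ℂ)) =
      ∑ I : Set.powersetCard ι p, PowerSeries.mk fun n =>
        (finrank ℂ (shiftedInvariants τ n (∑ i ∈ (I : Finset ι), (e i - 1))) : ℂ) := by
    ext n
    rw [PowerSeries.coeff_mk, hf.finrank_invariantForms, Nat.cast_sum, map_sum]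
    simp only [PowerSeries.coeff_mk]
  rw [h, Finset.sum_mul]
  refine Finset.sum_congr rfl fun I _ => ?_
  rw [mk_finrank_shiftedInvariants, mul_assoc, hf.mk_finrank_mul, mul_one]

theorem IsBasicInvariants.sum_trace_div_det (hf : IsBasicInvariants τ f e) (p : ℕ) {t : ℂ}
    (ht : ∀ g, (1 - t • τ g).det ≠ 0) :
    (∑ g, LinearMap.trace ℂ _ (exteriorPower.map p (Matrix.toLin' (τ g))) / (1 - t • τ g).det) *
        ∏ i, (1 - t ^ e i) =
      Fintype.card G * ∑ I : Set.powersetCard ι p, ∏ i ∈ (I : Finset ι), t ^ (e i - 1) := by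
  have h := eval_traceSeries τ (D := ∏ i, (1 - Polynomial.X ^ e i))
    (N := Polynomial.C (Fintype.card G : ℂ) *
      ∑ I : Set.powersetCard ι p, Polynomial.X ^ ∑ i ∈ (I : Finset ι), (e i - 1))
    (a := fun g => LinearMap.trace ℂ _ (exteriorPower.map p (Matrix.toLin' (τ g)))) (by
      rw [← card_mul_mk_finrank_invariantForms, coe_prod_one_sub_X_pow, mul_assoc,
        hf.mk_finrank_invariantForms, ← Polynomial.coeToPowerSeries.ringHom_apply, map_mul, map_sum]
      simp) ht
  simpa [Polynomial.eval_prod, Polynomial.eval_finsetSum, Finset.prod_pow_eq_pow_sum] using h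

end FormSeries

end Solomon

namespace Solomon

section Degrees

open Polynomial

theorem mem_of_prod_one_sub_X_pow_eq {s t : Multiset ℕ} {m : ℕ} (hm : m ≠ 0) (hms : m ∈ s)
    (hle : ∀ a ∈ t, a ≤ m) (ht : 0 ∉ t)
    (h : (s.map fun a => (1 - X ^ a : ℂ[X])).prod = (t.map fun a => (1 - X ^ a : ℂ[X])).prod) :
    m ∈ t := by
  have hζ := Complex.isPrimitiveRoot_exp m hm
  set ζ := Complex.exp (2 * Real.pi * Complex.I / m)
  have h0 : (s.map fun a => (1 - X ^ a : ℂ[X])).prod.eval ζ = 0 := by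
    rw [eval_multiset_prod, Multiset.map_map]
    refine Multiset.prod_eq_zero (Multiset.mem_map.2 ⟨m, hms, ?_⟩)
    simp [hζ.pow_eq_one]
  rw [h, eval_multiset_prod, Multiset.map_map, Multiset.prod_eq_zero_iff, Multiset.mem_map] at h0
  obtain ⟨a, ha, ha0⟩ := h0
  have hdvd : m ∣ a := by
    refine hζ.dvd_of_pow_eq_one a ?_
    have h1 : 1 - ζ ^ a = 0 := by simpa using ha0
    exact (sub_eq_zero.1 h1).symm
  have hapos : 0 < a := Nat.pos_of_ne_zero fun h => ht (h ▸ ha)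
  rwa [le_antisymm (Nat.le_of_dvd hapos hdvd) (hle a ha)]

/-- A multiset of positive integers is determined by the product of the `1 - X ^ a`. -/
theorem eq_of_prod_one_sub_X_pow_eq {s t : Multiset ℕ} (hs : 0 ∉ s) (ht : 0 ∉ t)
    (h : (s.map fun a => (1 - X ^ a : ℂ[X])).prod = (t.map fun a => (1 - X ^ a : ℂ[X])).prod) :
    s = t := by
  induction hn : s.card generalizing s t with
  | zero =>
    rw [Multiset.card_eq_zero] at hn
    subst hn
    refine (Multiset.eq_zero_of_forall_notMem fun a ha => ?_).symm
    have h1 := congrArg (eval 1) h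
    rw [eval_multiset_prod, eval_multiset_prod, Multiset.map_map, Multiset.map_map,
      Multiset.prod_eq_zero (s := t.map _) (Multiset.mem_map.2 ⟨a, ha, by simp⟩)] at h1
    simp at h1
  | succ n ih =>
    obtain ⟨m, hm, hmax⟩ := (s + t).toFinset.exists_max_image id (by
      obtain ⟨a, ha⟩ := Multiset.card_pos_iff_exists_mem.1 (by omega : 0 < s.card)
      exact ⟨a, by simp [ha]⟩)
    simp only [Multiset.mem_toFinset, Multiset.mem_add, id] at hm hmax
    have hm0 : m ≠ 0 := by
      rintro rfl
      exact hm.elim hs ht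
    have hms : m ∈ s := hm.elim id fun hmt =>
      mem_of_prod_one_sub_X_pow_eq hm0 hmt (fun a ha => hmax a (Or.inl ha)) hs h.symm
    have hmt : m ∈ t :=
      mem_of_prod_one_sub_X_pow_eq hm0 hms (fun a ha => hmax a (Or.inr ha)) ht h
    obtain ⟨s, rfl⟩ := Multiset.exists_cons_of_mem hms
    obtain ⟨t, rfl⟩ := Multiset.exists_cons_of_mem hmt
    have hX : (1 - X ^ m : ℂ[X]) ≠ 0 := fun h0 => by
      have := congrArg (eval 0) h0
      simp [hm0] at this
    rw [Multiset.map_cons, Multiset.map_cons, Multiset.prod_cons, Multiset.prod_cons] at h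
    rw [ih (fun h0 => hs (Multiset.mem_cons_of_mem h0)) (fun h0 => ht (Multiset.mem_cons_of_mem h0))
      (mul_left_cancel₀ hX h) (by simpa using hn)]

end Degrees

section Matrices

variable {ι G : Type*} [Fintype ι] [LinearOrder ι] [Group G] [Fintype G] {τ : G →* Matrix ι ι ℂ}
  {f : ι → MvPolynomial ι ℂ} {e : ι → ℕ}

theorem IsBasicInvariants.solomon (hf : IsBasicInvariants τ f e) {t : ℂ}
    (ht : ∀ g, (1 - t • τ g).det ≠ 0) (y : ℂ) :
    (∑ g, (1 + y • τ g).det / (1 - t • τ g).det) * ∏ i, (1 - t ^ e i) =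
      Fintype.card G * ∏ i, (1 + y * t ^ (e i - 1)) := by
  rw [← sum_powersetCard_pow_mul_prod, Finset.mul_sum]
  simp only [← sum_trace_exteriorPower Fintype.card_pos (map_pow_card τ _) y, Finset.sum_div]
  rw [Finset.sum_comm, Finset.sum_mul]
  refine Finset.sum_congr rfl fun p _ => ?_
  rw [← mul_assoc, ← hf.sum_trace_div_det p ht, mul_right_comm]
  congr 1
  rw [Finset.sum_mul]
  simp only [div_mul_eq_mul_div]

/-- Molien's formula determines the degrees of the basic invariants. -/
theorem IsBasicInvariants.map_degrees_eq (hf : IsBasicInvariants τ f e) {d : ι → ℕ}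
    (hd : ∀ i, 0 < d i)
    (h : ∀ t : ℂ, (∀ g, (1 - t • τ g).det ≠ 0) → (∀ i, 1 - t ^ d i ≠ 0) →
      (∑ g, 1 / (1 - t • τ g).det) * ∏ i, (1 - t ^ d i) = Fintype.card G) :
    Finset.univ.val.map e = Finset.univ.val.map d := by
  have hpoly : (∏ i, (1 - Polynomial.X ^ e i) : Polynomial ℂ) =
      ∏ i, (1 - Polynomial.X ^ d i) := by
    have hd0 : (∏ i, (1 - Polynomial.X ^ d i) : Polynomial ℂ) ≠ 0 :=
      Finset.prod_ne_zero_iff.2 fun i _ h0 => by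
        have := congrArg (Polynomial.eval 0) h0
        simp [(hd i).ne'] at this
    have hτ : ∏ g, (τ g).charpolyRev ≠ 0 :=
      Finset.prod_ne_zero_iff.2 fun g _ => charpolyRev_ne_zero _
    refine mul_left_cancel₀ (mul_ne_zero hτ hd0) (Polynomial.funext fun t => ?_)
    rw [Polynomial.eval_mul (q := ∏ i, (1 - Polynomial.X ^ e i)),
      Polynomial.eval_mul (p := (∏ g, (τ g).charpolyRev) * _)]
    by_cases ht : ((∏ g, (τ g).charpolyRev) * ∏ i, (1 - Polynomial.X ^ d i)).eval t = 0
    · rw [ht, zero_mul, zero_mul]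
    · congr 1
      rw [Polynomial.eval_mul, ← Ne, mul_ne_zero_iff, Polynomial.eval_prod, Polynomial.eval_prod,
        Finset.prod_ne_zero_iff, Finset.prod_ne_zero_iff] at ht
      have ht1 : ∀ g, (1 - t • τ g).det ≠ 0 := fun g => by
        rw [← eval_charpolyRev_eq_det]
        exact ht.1 g (Finset.mem_univ g)
      have h1 := hf.molien ht1
      have h2 := h t ht1 fun i => by simpa using ht.2 i (Finset.mem_univ i)
      have hcard : (Fintype.card G : ℂ) ≠ 0 := Nat.cast_ne_zero.2 Fintype.card_ne_zero
      have h3 := mul_left_cancel₀ (left_ne_zero_of_mul (h1 ▸ hcard)) (h1.trans h2.symm)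
      simpa [Polynomial.eval_prod] using h3
  refine eq_of_prod_one_sub_X_pow_eq ?_ ?_ ?_
  · simpa using fun i => (hf.pos i).ne'
  · simpa using fun i => (hd i).ne'
  · rw [Multiset.map_map, Multiset.map_map]
    exact hpoly

end Matrices

section Reflections

open MvPolynomial

theorem fixesHyperplane_of_eq {ι G : Type*} [Fintype ι] [DecidableEq ι] [Group G]
    {τ : G →* Matrix ι ι ℂ} {g : G} (hg : τ g ≠ 1) {u c : ι → ℂ}
    (h : ∀ i j, (τ g - 1) i j = c j * u i) :
    FixesHyperplane τ g := by
  have hX : ∀ i, subst (τ g) (X i) - X i = C (u i) * ∑ j, C (c j) * X j := fun i => by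
    have h1 : ∀ j, τ g i j = (1 : Matrix ι ι ℂ) i j + c j * u i := fun j => by
      rw [← h, Matrix.sub_apply, add_sub_cancel]
    simp only [subst_X, h1, map_add, map_mul, add_mul, Finset.sum_add_distrib, Finset.mul_sum,
      Matrix.one_apply]
    simp [mul_comm, mul_left_comm]
  refine ⟨∑ j, C (c j) * X j, fun h0 => hg ?_, ?_, fun p => ?_⟩
  · have hc : ∀ j, c j = 0 := fun j => by
      simpa [Pi.single_apply] using congrArg (eval (Pi.single j 1)) h0
    rw [← sub_eq_zero]
    ext i j
    rw [h, hc, zero_mul, Matrix.zero_apply]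
  · exact IsHomogeneous.sum _ _ _ fun j _ => (isHomogeneous_X ℂ j).C_mul _
  · induction p using MvPolynomial.induction_on with
    | C a => simp [← algebraMap_eq]
    | add p q hp hq =>
      rw [map_add, add_sub_add_comm]
      exact dvd_add hp hq
    | mul_X p i hp =>
      have h1 : subst (τ g) (p * X i) - p * X i =
          (subst (τ g) p - p) * subst (τ g) (X i) + p * (subst (τ g) (X i) - X i) := by
        rw [map_mul]; ring
      rw [h1, hX]
      exact dvd_add (hp.mul_right _) ((Dvd.intro_left _ rfl).mul_left _)

variable {V G : Type*} [AddCommGroup V] [Module ℂ V] [Group G]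

/-- The matrices of a representation in a basis. -/
noncomputable def matrixRep {ι : Type*} [Fintype ι] [DecidableEq ι] (ρ : Representation ℂ G V)
    (b : Basis ι ℂ V) : G →* Matrix ι ι ℂ :=
  (LinearMap.toMatrixAlgEquiv b : (V →ₗ[ℂ] V) →* Matrix ι ι ℂ).comp ρ

theorem det_one_add_smul_matrixRep {ι : Type*} [Fintype ι] [DecidableEq ι]
    (ρ : Representation ℂ G V) (b : Basis ι ℂ V) (y : ℂ) (g : G) :
    (1 + y • matrixRep ρ b g).det = LinearMap.det ((1 : Module.End ℂ V) + y • ρ g) := by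
  have h : 1 + y • matrixRep ρ b g = LinearMap.toMatrixAlgEquiv b (1 + y • ρ g) := by
    rw [map_add, map_one, map_smul]
    rfl
  rw [h, ← LinearMap.det_toMatrix b]
  rfl

theorem det_one_sub_smul_matrixRep {ι : Type*} [Fintype ι] [DecidableEq ι]
    (ρ : Representation ℂ G V) (b : Basis ι ℂ V) (t : ℂ) (g : G) :
    (1 - t • matrixRep ρ b g).det = LinearMap.det ((1 : Module.End ℂ V) - t • ρ g) := by
  have h := det_one_add_smul_matrixRep ρ b (-t) g
  simpa only [neg_smul, ← sub_eq_add_neg] using h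

theorem fixesHyperplane_matrixRep [FiniteDimensional ℂ V] {ι : Type*} [Fintype ι]
    [DecidableEq ι]
    {ρ : Representation ℂ G V} (hρ : Function.Injective ρ) (b : Basis ι ℂ V) {g : G} (hg : g ≠ 1)
    (h : finrank ℂ (LinearMap.ker ((ρ g : Module.End ℂ V) - 1)) = finrank ℂ V - 1) :
    FixesHyperplane (matrixRep ρ b) g := by
  have hρg : ρ g ≠ 1 := fun h1 => hg (hρ (h1.trans (map_one ρ).symm))
  have hV : 0 < finrank ℂ V := by
    by_contra h0
    have := finrank_zero_iff.1 (Nat.eq_zero_of_not_pos h0)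
    exact hρg (Subsingleton.elim _ _)
  have hrange : finrank ℂ (LinearMap.range ((ρ g : Module.End ℂ V) - 1)) = 1 := by
    have := LinearMap.finrank_range_add_finrank_ker ((ρ g : Module.End ℂ V) - 1)
    omega
  obtain ⟨v, -, hv⟩ := finrank_eq_one_iff'.1 hrange
  choose c hc using fun j => hv ⟨((ρ g : Module.End ℂ V) - 1) (b j), LinearMap.mem_range_self _ _⟩
  refine fixesHyperplane_of_eq (u := fun i => b.repr v i) (c := c) (fun h1 => hρg ?_) fun i j => ?_
  · exact (LinearMap.toMatrixAlgEquiv b).injective (h1.trans (map_one _).symm)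
  · have h1 : matrixRep ρ b g - 1 = LinearMap.toMatrixAlgEquiv b (ρ g - 1) := by
      rw [map_sub, map_one]
      rfl
    have h2 : ((ρ g : Module.End ℂ V) - 1) (b j) = c j • (v : V) :=
      (congrArg Subtype.val (hc j)).symm
    rw [h1, LinearMap.toMatrixAlgEquiv_apply, h2, map_smul]
    rfl

end Reflections

end Solomon

/-- Solomon's formula: let `W ⊂ GL(h)` be a finite complex
reflection group acting (faithfully, generated by pseudo-reflections) on `h`
of dimension `ℓ`, with degrees `d_1,…,d_ℓ` of basic invariants (characterized
here by Molien's formula `(1/|W|)Σ_w 1/det(1-t·w) = Π_i 1/(1-t^{d_i})`).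
Then, as rational functions in `t, y`:
`(1/|W|)·Σ_{w∈W} det(1 + y·w)/det(1 − t·w) = Π_i (1 + y·t^{d_i−1})/(1 − t^{d_i})`. -/
theorem stmt4 {V : Type*} [AddCommGroup V] [Module ℂ V] [FiniteDimensional ℂ V]
    {G : Type*} [Group G] [Fintype G] (ρ : Representation ℂ G V)
    (hfaith : Function.Injective ρ)
    (hgen : Subgroup.closure {g : G | g ≠ 1 ∧
        finrank ℂ (LinearMap.ker ((ρ g : Module.End ℂ V) - 1)) = finrank ℂ V - 1} = ⊤)
    (d : Fin (finrank ℂ V) → ℕ) (hd : ∀ i, 0 < d i)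
    (hMolien : ∀ t : ℂ,
      (∀ g : G, LinearMap.det ((1 : Module.End ℂ V) - t • ρ g) ≠ 0) →
      (∀ i, (1 : ℂ) - t ^ d i ≠ 0) →
      (∑ g : G, (LinearMap.det ((1 : Module.End ℂ V) - t • ρ g))⁻¹) /
          (Fintype.card G : ℂ) = ∏ i, ((1 : ℂ) - t ^ d i)⁻¹) :
    ∀ t y : ℂ,
      (∀ g : G, LinearMap.det ((1 : Module.End ℂ V) - t • ρ g) ≠ 0) →
      (∀ i, (1 : ℂ) - t ^ d i ≠ 0) →
      (∑ g : G, LinearMap.det ((1 : Module.End ℂ V) + y • ρ g) /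
          LinearMap.det ((1 : Module.End ℂ V) - t • ρ g)) / (Fintype.card G : ℂ) =
        ∏ i, (1 + y * t ^ (d i - 1)) / (1 - t ^ d i) := by
  have hcard : (Fintype.card G : ℂ) ≠ 0 := Nat.cast_ne_zero.2 Fintype.card_ne_zero
  set b := finBasis ℂ V
  have hgen' : Subgroup.closure {g : G | Solomon.FixesHyperplane (Solomon.matrixRep ρ b) g} = ⊤ :=
    top_le_iff.1 (hgen.ge.trans (Subgroup.closure_mono fun g hg =>
      Solomon.fixesHyperplane_matrixRep hfaith b hg.1 hg.2))
  obtain ⟨f, e, hf⟩ := Solomon.exists_isBasicInvariants hgen'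
  have hed : Finset.univ.val.map e = Finset.univ.val.map d := by
    refine hf.map_degrees_eq hd fun t ht htd => ?_
    simp only [Solomon.det_one_sub_smul_matrixRep] at ht ⊢
    have h := hMolien t ht htd
    rw [Finset.prod_inv_distrib, div_eq_iff hcard] at h
    simp only [one_div]
    rw [h, mul_right_comm, inv_mul_cancel₀ (Finset.prod_ne_zero_iff.2 fun i _ => htd i), one_mul]
  have hprod : ∀ F : ℕ → ℂ, ∏ i, F (e i) = ∏ i, F (d i) := fun F => by
    have h := congrArg (fun s => (Multiset.map F s).prod) hed
    simp only [Multiset.map_map] at h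
    exact h
  intro t y ht htd
  have h := hf.solomon (t := t) (by simpa only [Solomon.det_one_sub_smul_matrixRep] using ht) y
  simp only [Solomon.det_one_sub_smul_matrixRep, Solomon.det_one_add_smul_matrixRep] at h
  rw [hprod fun a => 1 - t ^ a, hprod fun a => 1 + y * t ^ (a - 1)] at h
  rw [Finset.prod_div_distrib, div_eq_div_iff hcard (Finset.prod_ne_zero_iff.2 fun i _ => htd i), h,
    mul_comm]
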